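/- Let g, φ : ℝ → ℝ be infinitely differentiable and set Y = g(B). Then for every T > 0, sup_{0 ≤ t ≤ T} | φ(Y(⌊nt⌋/n)) − φ(Y(0)) − ∑_{j=1}^{⌊nt⌋} ((φ'(Y(t_{j−1})) + φ'(Y(t_j)))/2)(Y(t_j) − Y(t_{j−1})) + (1/12) ∑_{j=1}^{⌊nt⌋} ((φ'''(Y(t_{j−1})) + φ'''(Y(t_j)))/2)(Y(t_j) − Y(t_{j−1}))³ | → 0 in probability as n → ∞. (This is the Itô-type formula φ(Y(t)) = φ(Y(0)) + ∫_0^t φ'(Y) dY − (1/12)∫_0^t φ'''(Y) d⟦Y⟧ at the level of Riemann-sum representatives.) -/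

import Mathlib

open MeasureTheory ProbabilityTheory Filter Topology

noncomputable section

/-- `B` is a fractional Brownian motion with Hurst parameter `1/6`: a centered Gaussian
process with continuous sample paths and covariance
`E[B s * B t] = (t^(1/3) + s^(1/3) - |t - s|^(1/3)) / 2` for `s, t ≥ 0`. -/
def IsFBM16 {Ω : Type*} [MeasureSpace Ω] (B : ℝ → Ω → ℝ) : Prop :=
  (∀ t : ℝ, Measurable (B t)) ∧
  (∀ ω : Ω, Continuous fun t : ℝ => B t ω) ∧
  (∀ (m : ℕ) (t : Fin m → ℝ) (c : Fin m → ℝ), (∀ i, 0 ≤ t i) →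
    ∃ v : NNReal,
      Measure.map (fun ω => ∑ i, c i * B (t i) ω) (volume : Measure Ω) = gaussianReal 0 v) ∧
  (∀ s t : ℝ, 0 ≤ s → 0 ≤ t →
    ∫ ω, B s ω * B t ω =
      (t ^ ((1 : ℝ) / 3) + s ^ ((1 : ℝ) / 3) - |t - s| ^ ((1 : ℝ) / 3)) / 2)

/-- Taylor's formula with a remainder bound uniform over base points in a compact interval. -/
theorem exists_taylor_bound {ψ : ℝ → ℝ} (hψ : ContDiff ℝ (⊤ : ℕ∞) ψ) (R : ℝ) (k : ℕ) :
    ∃ C : ℝ, 0 ≤ C ∧ ∀ c r : ℝ, |c| ≤ R → |r| ≤ R →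
      |ψ (c + r) - ∑ i ∈ Finset.range k, iteratedDeriv i ψ c * r ^ i / (i.factorial : ℝ)|
        ≤ C * |r| ^ k := by
  induction k generalizing ψ with
  | zero =>
    obtain ⟨C, hC⟩ := (isCompact_Icc (a := -(2 * R)) (b := 2 * R)).exists_bound_of_continuousOn
      hψ.continuous.continuousOn
    refine ⟨max C 0, le_max_right _ _, fun c r hc hr => ?_⟩
    have h : |c + r| ≤ 2 * R := (abs_add_le c r).trans (by linarith)
    simpa using (hC (c + r) ⟨(abs_le.1 h).1, (abs_le.1 h).2⟩).trans (le_max_left C 0)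
  | succ k ih =>
    have hψ' : ContDiff ℝ (⊤ : ℕ∞) (deriv ψ) :=
      ((contDiff_succ_iff_deriv (n := (⊤ : ℕ∞))).1 (by simpa using hψ)).2.2
    obtain ⟨C, hC0, hC⟩ := ih hψ'
    refine ⟨C, hC0, fun c r hc hr => ?_⟩
    have hdiff : Differentiable ℝ ψ := hψ.differentiable (by simp)
    set D : ℝ → ℝ := fun x => ψ (c + x) -
      ∑ i ∈ Finset.range (k + 1), iteratedDeriv i ψ c * x ^ i / (i.factorial : ℝ) with hD
    have hder : ∀ x, HasDerivAt D (deriv ψ (c + x) -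
        ∑ i ∈ Finset.range k, iteratedDeriv i (deriv ψ) c * x ^ i / (i.factorial : ℝ)) x := by
      intro x
      have h1 : HasDerivAt (fun x => ψ (c + x)) (deriv ψ (c + x)) x :=
        (hdiff (c + x)).hasDerivAt.comp_const_add c x
      have h2 : HasDerivAt (fun x : ℝ => ∑ i ∈ Finset.range (k + 1),
          iteratedDeriv i ψ c * x ^ i / (i.factorial : ℝ))
          (∑ i ∈ Finset.range (k + 1),
            iteratedDeriv i ψ c * ((i : ℝ) * x ^ (i - 1)) / (i.factorial : ℝ)) x :=
        HasDerivAt.fun_sum fun i _ => ((hasDerivAt_pow i x).const_mul _).div_const _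
      have h3 : ∑ i ∈ Finset.range (k + 1),
            iteratedDeriv i ψ c * ((i : ℝ) * x ^ (i - 1)) / (i.factorial : ℝ) =
          ∑ i ∈ Finset.range k, iteratedDeriv i (deriv ψ) c * x ^ i / (i.factorial : ℝ) := by
        rw [Finset.sum_range_succ']
        simp only [Nat.cast_zero, zero_mul, mul_zero, zero_div, add_zero]
        refine Finset.sum_congr rfl fun i _ => ?_
        rw [iteratedDeriv_succ', Nat.factorial_succ]
        push_cast
        have : (i.factorial : ℝ) ≠ 0 := by positivity
        have : (i : ℝ) + 1 ≠ 0 := by positivity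
        field_simp
      rw [← h3]
      exact h1.sub h2
    have hD0 : D 0 = 0 := by
      simp [hD, Finset.sum_range_succ']
    have hmv := (convex_Icc (-|r|) |r|).norm_image_sub_le_of_norm_hasDerivWithin_le
      (f := D) (C := C * |r| ^ k) (x := 0) (y := r) (fun x _ => (hder x).hasDerivWithinAt)
      (fun x hx => ?_) ⟨by simp, by simp⟩ ⟨neg_abs_le r, le_abs_self r⟩
    · rw [hD0] at hmv
      simpa [pow_succ, mul_assoc] using hmv
    · have hx' : |x| ≤ |r| := abs_le.2 hx
      refine (hC c x hc (hx'.trans hr)).trans ?_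
      gcongr

/-- Fifth order expansion of the corrected trapezoidal rule around the midpoint. -/
theorem exists_trapezoid_bound {φ : ℝ → ℝ} (hφ : ContDiff ℝ (⊤ : ℕ∞) φ) (R : ℝ) :
    ∃ C : ℝ, 0 ≤ C ∧ ∀ m d : ℝ, |m| ≤ R → |d| ≤ R →
      |φ (m + d) - φ (m - d) - (deriv φ (m - d) + deriv φ (m + d)) / 2 * (2 * d)
        + (1 / 12) * ((iteratedDeriv 3 φ (m - d) + iteratedDeriv 3 φ (m + d)) / 2 * (2 * d) ^ 3)
        - (1 / 120) * iteratedDeriv 5 φ m * (2 * d) ^ 5| ≤ C * |d| ^ 7 := by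
  have hφ1 : ContDiff ℝ (⊤ : ℕ∞) (iteratedDeriv 1 φ) := by
    rw [iteratedDeriv_eq_iterate]; exact hφ.iterate_deriv 1
  have hφ3 : ContDiff ℝ (⊤ : ℕ∞) (iteratedDeriv 3 φ) := by
    rw [iteratedDeriv_eq_iterate]; exact hφ.iterate_deriv 3
  obtain ⟨C0, hC0, h0⟩ := exists_taylor_bound hφ R 7
  obtain ⟨C1, hC1, h1⟩ := exists_taylor_bound hφ1 R 6
  obtain ⟨C3, hC3, h3⟩ := exists_taylor_bound hφ3 R 4
  refine ⟨2 * C0 + 2 * C1 + 2 * C3, by positivity, fun m d hm hd => ?_⟩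
  have hd' : |-d| ≤ R := by simpa using hd
  have e1 : ∀ i, iteratedDeriv i (iteratedDeriv 1 φ) m = iteratedDeriv (i + 1) φ m := by
    intro i; simp only [iteratedDeriv_eq_iterate, ← Function.iterate_add_apply]
  have e3 : ∀ i, iteratedDeriv i (iteratedDeriv 3 φ) m = iteratedDeriv (i + 3) φ m := by
    intro i; simp only [iteratedDeriv_eq_iterate, ← Function.iterate_add_apply]
  have a0 := h0 m d hm hd
  have b0 := h0 m (-d) hm hd'
  have a1 := h1 m d hm hd
  have b1 := h1 m (-d) hm hd'
  have a3 := h3 m d hm hd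
  have b3 := h3 m (-d) hm hd'
  simp only [e1, e3, Finset.sum_range_succ, Finset.sum_range_zero, Nat.factorial, abs_neg,
    ← sub_eq_add_neg] at a0 b0 a1 b1 a3 b3
  norm_num at a0 b0 a1 b1 a3 b3
  generalize deriv φ m = p1 at *
  generalize iteratedDeriv 2 φ m = p2 at *
  generalize iteratedDeriv 3 φ m = p3 at *
  generalize iteratedDeriv 4 φ m = p4 at *
  generalize iteratedDeriv 5 φ m = p5 at *
  generalize iteratedDeriv 6 φ m = p6 at *
  have mul_bound : ∀ {r C : ℝ} {i : ℕ} (l : ℕ), |r| ≤ C * |d| ^ i →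
      |r * d ^ l| ≤ C * |d| ^ (i + l) := by
    intro r C i l h
    rw [abs_mul, abs_pow, pow_add, ← mul_assoc]
    gcongr
  have a1' := abs_le.1 (mul_bound 1 a1)
  have b1' := abs_le.1 (mul_bound 1 b1)
  have a3' := abs_le.1 (mul_bound 3 a3)
  have b3' := abs_le.1 (mul_bound 3 b3)
  rw [abs_le] at a0 b0 ⊢
  have hd7 : 0 ≤ C3 * |d| ^ 7 := by positivity
  norm_num at a1' b1' a3' b3'
  constructor
  · linarith [a0.1, b0.2, a1'.2, b1'.2, a3'.1, b3'.1]
  · linarith [a0.2, b0.1, a1'.1, b1'.1, a3'.2, b3'.2]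

theorem abs_pow_five_sub_le {a b K : ℝ} (ha : |a| ≤ K) (hb : |b| ≤ K) :
    |a ^ 5 - b ^ 5| ≤ 5 * K ^ 4 * |a - b| := by
  have hK : 0 ≤ K := (abs_nonneg a).trans ha
  have h : a ^ 5 - b ^ 5 = (a ^ 4 + a ^ 3 * b + a ^ 2 * b ^ 2 + a * b ^ 3 + b ^ 4) * (a - b) := by
    ring
  have hm : ∀ i j : ℕ, |a ^ i * b ^ j| ≤ K ^ i * K ^ j := by
    intro i j
    rw [abs_mul, abs_pow, abs_pow]
    gcongr
  have h1 : |a ^ 4 + a ^ 3 * b + a ^ 2 * b ^ 2 + a * b ^ 3 + b ^ 4| ≤ 5 * K ^ 4 := by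
    have h40 := abs_le.1 (hm 4 0)
    have h31 := abs_le.1 (hm 3 1)
    have h22 := abs_le.1 (hm 2 2)
    have h13 := abs_le.1 (hm 1 3)
    have h04 := abs_le.1 (hm 0 4)
    simp only [pow_zero, pow_one, mul_one, one_mul] at h40 h31 h22 h13 h04
    rw [abs_le]
    constructor <;> nlinarith
  rw [h, abs_mul]
  gcongr

/-- The one-step error of the corrected trapezoidal rule for `φ ∘ g`. -/
def stepError (g φ : ℝ → ℝ) (x y : ℝ) : ℝ :=
  φ (g y) - φ (g x) - (deriv φ (g x) + deriv φ (g y)) / 2 * (g y - g x)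
    + (1 / 12) * ((iteratedDeriv 3 φ (g x) + iteratedDeriv 3 φ (g y)) / 2 * (g y - g x) ^ 3)

/-- The coefficient of the fifth power in the expansion of `stepError` around the midpoint. -/
def fifthCoeff (g φ : ℝ → ℝ) (c : ℝ) : ℝ :=
  (1 / 120) * iteratedDeriv 5 φ (g c) * deriv g c ^ 5

theorem abs_half_add_le {a b E : ℝ} (ha : |a| ≤ E) (hb : |b| ≤ E) : |(a + b) / 2| ≤ E := by
  rw [abs_le] at *
  constructor <;> linarith [ha.1, ha.2, hb.1, hb.2]

theorem abs_half_sub_le {a b E : ℝ} (ha : |a| ≤ E) (hb : |b| ≤ E) : |(a - b) / 2| ≤ E := by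
  rw [abs_le] at *
  constructor <;> linarith [ha.1, ha.2, hb.1, hb.2]

theorem exists_stepError_bound {g φ : ℝ → ℝ} (hg : ContDiff ℝ (⊤ : ℕ∞) g)
    (hφ : ContDiff ℝ (⊤ : ℕ∞) φ) (M : ℝ) :
    ∃ C : ℝ, 0 ≤ C ∧ ∀ x y : ℝ, |x| ≤ M → |y| ≤ M →
      |stepError g φ x y - fifthCoeff g φ ((x + y) / 2) * (y - x) ^ 5| ≤ C * |y - x| ^ 7 := by
  have hφ5 : ContDiff ℝ (⊤ : ℕ∞) (iteratedDeriv 5 φ) := by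
    rw [iteratedDeriv_eq_iterate]; exact hφ.iterate_deriv 5
  have hg1 : ContDiff ℝ (⊤ : ℕ∞) (deriv g) := hg.iterate_deriv 1
  obtain ⟨G0, hG0, hg0⟩ := exists_taylor_bound hg M 0
  obtain ⟨G1, hG1, hg1'⟩ := exists_taylor_bound hg M 1
  obtain ⟨G2, hG2, hg2⟩ := exists_taylor_bound hg M 2
  obtain ⟨G3, hG3, hg3⟩ := exists_taylor_bound hg M 3
  obtain ⟨G, hG, hgd⟩ := exists_taylor_bound hg1 M 0
  obtain ⟨C, hC, htrap⟩ := exists_trapezoid_bound hφ (2 * G0)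
  obtain ⟨P, hP, hφbound⟩ := exists_taylor_bound hφ5 (2 * G0) 0
  obtain ⟨Q, hQ, hφlip⟩ := exists_taylor_bound hφ5 (2 * G0) 1
  refine ⟨C * G1 ^ 7 + Q * G2 * (2 * G1) ^ 5 + P * (5 * (2 * G1 + 2 * G) ^ 4 * (2 * G3)),
    by positivity, fun x y hx hy => ?_⟩
  obtain ⟨c, hc⟩ : ∃ c, c = (x + y) / 2 := ⟨_, rfl⟩
  obtain ⟨r, hr⟩ : ∃ r, r = (y - x) / 2 := ⟨_, rfl⟩
  have hxc : x = c - r := by rw [hc, hr]; ring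
  have hyc : y = c + r := by rw [hc, hr]; ring
  have hcM : |c| ≤ M := hc ▸ abs_half_add_le hx hy
  have hrM : |r| ≤ M := hr ▸ abs_half_sub_le hy hx
  have hrM' : |-r| ≤ M := by simpa using hrM
  have hyx : |y - x| = 2 * |r| := by
    rw [show y - x = 2 * r by rw [hr]; ring, abs_mul, abs_of_pos (by norm_num : (0 : ℝ) < 2)]
  have u0 := hg0 c r hcM hrM
  have v0 := hg0 c (-r) hcM hrM'
  have u1 := hg1' c r hcM hrM
  have v1 := hg1' c (-r) hcM hrM'
  have u2 := hg2 c r hcM hrM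
  have v2 := hg2 c (-r) hcM hrM'
  have u3 := hg3 c r hcM hrM
  have v3 := hg3 c (-r) hcM hrM'
  have gc := hg0 c 0 hcM (by simpa using (abs_nonneg c).trans hcM)
  have gd := hgd c 0 hcM (by simpa using (abs_nonneg c).trans hcM)
  simp only [Finset.sum_range_succ, Finset.sum_range_zero, Nat.factorial, abs_neg,
    ← sub_eq_add_neg, ← hxc, ← hyc] at u0 v0 u1 v1 u2 v2 u3 v3 gc gd
  norm_num at u0 v0 u1 v1 u2 v2 u3 v3 gc gd
  rw [← hc, stepError, fifthCoeff]
  have hm : |(g x + g y) / 2| ≤ 2 * G0 := (abs_half_add_le v0 u0).trans (by linarith)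
  have hd : |(g y - g x) / 2| ≤ 2 * G0 := (abs_half_sub_le u0 v0).trans (by linarith)
  have hd1 : |(g y - g x) / 2| ≤ G1 * |r| := by
    simpa using abs_half_sub_le u1 v1
  have hm2 : |(g x + g y) / 2 - g c| ≤ G2 * |r| ^ 2 := by
    rw [sq_abs]
    refine le_of_eq_of_le (congrArg _ ?_) (abs_half_add_le v2 u2)
    ring
  have hmb : |(g x + g y) / 2 - g c| ≤ 2 * G0 := by
    refine (abs_sub _ _).trans ?_
    linarith [abs_half_add_le v0 u0]
  have hd3 : |(g y - g x) - 2 * r * deriv g c| ≤ 2 * G3 * |r| ^ 3 := by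
    have h := abs_half_sub_le u3 v3
    rw [abs_div, abs_of_pos (by norm_num : (0 : ℝ) < 2), div_le_iff₀ (by norm_num)] at h
    refine le_of_eq_of_le (congrArg _ ?_) (h.trans_eq (by ring))
    ring
  have t1 := htrap _ _ hm hd
  rw [show (g x + g y) / 2 + (g y - g x) / 2 = g y by ring,
    show (g x + g y) / 2 - (g y - g x) / 2 = g x by ring,
    show 2 * ((g y - g x) / 2) = g y - g x by ring] at t1
  have t1' : C * |(g y - g x) / 2| ^ 7 ≤ C * G1 ^ 7 * |r| ^ 7 := by
    rw [mul_assoc, ← mul_pow]; gcongr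
  have p1 := hφlip (g c) ((g x + g y) / 2 - g c) (by linarith) hmb
  have p0 := hφbound (g c) 0 (by linarith) (by simpa using hG0)
  simp at p1 p0
  have hdiff : |g y - g x| ≤ 2 * G1 * |r| := by
    rw [abs_div, abs_of_pos (by norm_num : (0 : ℝ) < 2), div_le_iff₀ (by norm_num)] at hd1
    linarith
  have t2 : |(iteratedDeriv 5 φ ((g x + g y) / 2) - iteratedDeriv 5 φ (g c)) * (g y - g x) ^ 5|
      ≤ Q * G2 * (2 * G1) ^ 5 * |r| ^ 7 := by
    rw [abs_mul, abs_pow]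
    calc _ ≤ (Q * (G2 * |r| ^ 2)) * (2 * G1 * |r|) ^ 5 := by
          gcongr
          exact p1.trans (by gcongr)
      _ = _ := by ring
  have t3 : |iteratedDeriv 5 φ (g c) * ((g y - g x) ^ 5 - (2 * r * deriv g c) ^ 5)|
      ≤ P * (5 * (2 * G1 + 2 * G) ^ 4 * (2 * G3)) * |r| ^ 7 := by
    rw [abs_mul]
    have h5 := abs_pow_five_sub_le (a := g y - g x) (b := 2 * r * deriv g c)
      (K := (2 * G1 + 2 * G) * |r|) (hdiff.trans (by gcongr; linarith)) (by
        rw [abs_mul, abs_mul, abs_of_pos (by norm_num : (0 : ℝ) < 2)]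
        nlinarith [abs_nonneg r])
    calc _ ≤ P * (5 * ((2 * G1 + 2 * G) * |r|) ^ 4 * (2 * G3 * |r| ^ 3)) := by
          gcongr
          exact h5.trans (by gcongr)
      _ = _ := by ring
  have hr7 : |r| ^ 7 ≤ |y - x| ^ 7 := by
    rw [hyx]; gcongr; linarith [abs_nonneg r]
  refine le_trans ?_ (mul_le_mul_of_nonneg_left hr7 (by positivity))
  rw [show y - x = 2 * r by rw [hr]; ring]
  have hsum : ∀ a b c A B D : ℝ, |a| ≤ A → |b| ≤ B → |c| ≤ D →
      |a + (1 / 120) * b + (1 / 120) * c| ≤ A + B + D := by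
    intro a b c A B D ha hb hc
    have hB := (abs_nonneg b).trans hb
    have hD := (abs_nonneg c).trans hc
    rw [abs_le] at *
    constructor <;> linarith [ha.1, ha.2, hb.1, hb.2, hc.1, hc.2]
  rw [add_mul, add_mul]
  refine le_of_eq_of_le (congrArg _ ?_) (hsum _ _ _ _ _ _ (t1.trans t1') t2 t3)
  ring

section Gaussian

variable {Ω : Type*} [MeasurableSpace Ω] {μ : Measure Ω}

theorem map_eq_gaussianReal_integral_sq {S : Ω → ℝ} (hS : Measurable S)
    (hG : ∃ v : NNReal, μ.map S = gaussianReal 0 v) :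
    μ.map S = gaussianReal 0 (∫ ω, S ω ^ 2 ∂μ).toNNReal := by
  obtain ⟨v, hv⟩ := hG
  have h1 : ∫ ω, S ω ^ 2 ∂μ = ∫ x, x ^ 2 ∂(gaussianReal 0 v) := by
    rw [← hv, integral_map hS.aemeasurable (by fun_prop)]
  have h2 : ∫ x, x ^ 2 ∂(gaussianReal 0 v) = v := by
    have h := variance_fun_id_gaussianReal (μ := 0) (v := v)
    rwa [variance_of_integral_eq_zero (by fun_prop) (by simp)] at h
  rw [h1, h2, hv, Real.toNNReal_coe]

theorem memLp_of_map_eq_gaussianReal {S : Ω → ℝ} (hS : Measurable S)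
    (hG : ∃ v : NNReal, μ.map S = gaussianReal 0 v) (p : ENNReal) (hp : p ≠ ⊤) :
    MemLp S p μ := by
  obtain ⟨v, hv⟩ := hG
  have h := memLp_id_gaussianReal' (μ := 0) (v := v) p hp
  rw [← hv, memLp_map_measure_iff (by fun_prop) hS.aemeasurable] at h
  exact h

/-- A centered Gaussian vector has the same law as its reflection along one of its
normalized coordinates. -/
theorem map_reflection_eq {ι : Type*} [Fintype ι] [IsProbabilityMeasure μ] {X : ι → Ω → ℝ}
    (hX : ∀ i, Measurable (X i))
    (hG : ∀ a : ι → ℝ, ∃ v : NNReal, μ.map (fun ω => ∑ i, a i * X i ω) = gaussianReal 0 v)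
    (k : ι) (hk : ∫ ω, X k ω ^ 2 ∂μ = 1) :
    μ.map (fun ω i => X i ω) =
      μ.map (fun ω i => X i ω - 2 * (∫ ω', X i ω' * X k ω' ∂μ) * X k ω) := by
  classical
  have hL2 : ∀ i, MemLp (X i) 2 μ := by
    intro i
    refine memLp_of_map_eq_gaussianReal (hX i) ?_ 2 (by simp)
    simpa [Pi.single_apply] using hG (Pi.single i 1)
  have hmul : ∀ i j, Integrable (fun ω => X i ω * X j ω) μ := fun i j =>
    (hL2 i).integrable_mul (hL2 j)
  have hm1 : Measurable (fun ω i => X i ω) := measurable_pi_lambda _ hX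
  have hm2 : Measurable (fun ω i => X i ω - 2 * (∫ ω', X i ω' * X k ω' ∂μ) * X k ω) :=
    measurable_pi_lambda _ fun i => (hX i).sub ((hX k).const_mul _)
  have : IsProbabilityMeasure (μ.map (fun ω i => X i ω)) :=
    Measure.isProbabilityMeasure_map hm1.aemeasurable
  have : IsProbabilityMeasure
      (μ.map (fun ω i => X i ω - 2 * (∫ ω', X i ω' * X k ω' ∂μ) * X k ω)) :=
    Measure.isProbabilityMeasure_map hm2.aemeasurable
  refine Measure.ext_of_charFunDual (funext fun L => ?_)
  have hLm : Measurable L := L.continuous.measurable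
  rw [charFunDual_eq_charFun_map_one, charFunDual_eq_charFun_map_one,
    Measure.map_map hLm hm1, Measure.map_map hLm hm2]
  congr 1
  obtain ⟨a, ha⟩ : ∃ a : ι → ℝ, ∀ x, L x = ∑ i, a i * x i := by
    refine ⟨fun i => L (Pi.single i 1), fun x => ?_⟩
    conv_lhs => rw [pi_eq_sum_univ' x, map_sum]
    refine Finset.sum_congr rfl fun i _ => ?_
    rw [map_smul, smul_eq_mul, mul_comm]
  set γ : ℝ := ∑ i, a i * ∫ ω', X i ω' * X k ω' ∂μ with hγ
  have e1 : (L ∘ fun ω i => X i ω) = fun ω => ∑ i, a i * X i ω := by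
    ext ω; simp [ha]
  have e2 : (L ∘ fun ω i => X i ω - 2 * (∫ ω', X i ω' * X k ω' ∂μ) * X k ω) =
      fun ω => (∑ i, a i * X i ω) - 2 * γ * X k ω := by
    ext ω
    simp only [Function.comp, ha, mul_sub, Finset.sum_sub_distrib, hγ, Finset.mul_sum,
      Finset.sum_mul]
    congr 1
    refine Finset.sum_congr rfl fun i _ => by ring
  have e3 : (fun ω => (∑ i, a i * X i ω) - 2 * γ * X k ω) =
      fun ω => ∑ i, (a i - if i = k then 2 * γ else 0) * X i ω := by
    ext ω
    simp [sub_mul, Finset.sum_sub_distrib, ite_mul]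
  have hSm : Measurable (fun ω => ∑ i, a i * X i ω) := by fun_prop
  have hSk : Integrable (fun ω => (∑ i, a i * X i ω) * X k ω) μ := by
    simp only [Finset.sum_mul, mul_assoc]
    exact integrable_finsetSum _ fun i _ => (hmul i k).const_mul _
  have hSkv : ∫ ω, (∑ i, a i * X i ω) * X k ω ∂μ = γ := by
    simp only [Finset.sum_mul, mul_assoc]
    rw [integral_finsetSum _ fun i _ => (hmul i k).const_mul _]
    simp only [integral_const_mul, hγ]
  have hSS : Integrable (fun ω => (∑ i, a i * X i ω) ^ 2) μ :=
    (memLp_of_map_eq_gaussianReal hSm (hG a) 2 (by simp)).integrable_sq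
  have hkk : Integrable (fun ω => X k ω ^ 2) μ := (hL2 k).integrable_sq
  rw [e1, e2, map_eq_gaussianReal_integral_sq hSm (hG a),
    map_eq_gaussianReal_integral_sq (by fun_prop) (by rw [e3]; exact hG _)]
  congr 2
  have e4 : (fun ω => ((∑ i, a i * X i ω) - 2 * γ * X k ω) ^ 2) = fun ω =>
      (∑ i, a i * X i ω) ^ 2 - (4 * γ) * ((∑ i, a i * X i ω) * X k ω)
        + (4 * γ ^ 2) * X k ω ^ 2 := by
    ext ω; ring
  have hsub : Integrable (fun ω => (∑ i, a i * X i ω) ^ 2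
      - (4 * γ) * ((∑ i, a i * X i ω) * X k ω)) μ := hSS.sub (hSk.const_mul _)
  rw [e4, integral_add hsub (hkk.const_mul _),
    integral_sub hSS (hSk.const_mul _), integral_const_mul, integral_const_mul, hSkv, hk]
  ring

/-- The `p`-th absolute moment of the standard normal distribution. -/
def gaussMoment (p : ℕ) : ℝ := ∫ x, |x| ^ p ∂(gaussianReal 0 1)

theorem gaussMoment_nonneg (p : ℕ) : 0 ≤ gaussMoment p :=
  integral_nonneg fun _ => by positivity

theorem map_eq_standard {V : Ω → ℝ} (hV : Measurable V)
    (hG : ∃ v : NNReal, μ.map V = gaussianReal 0 v) (h1 : ∫ ω, V ω ^ 2 ∂μ = 1) :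
    μ.map V = gaussianReal 0 1 := by
  rw [map_eq_gaussianReal_integral_sq hV hG, h1, Real.toNNReal_one]

theorem integral_abs_pow_eq_gaussMoment {V : Ω → ℝ} (hV : Measurable V)
    (h : μ.map V = gaussianReal 0 1) (p : ℕ) : ∫ ω, |V ω| ^ p ∂μ = gaussMoment p := by
  rw [gaussMoment, ← h, integral_map hV.aemeasurable (by fun_prop)]

theorem integrable_abs_pow_of_gaussian {V : Ω → ℝ} [IsProbabilityMeasure μ] (hV : Measurable V)
    (h : ∃ v : NNReal, μ.map V = gaussianReal 0 v) (p : ℕ) :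
    Integrable (fun ω => |V ω| ^ p) μ := by
  have h := (memLp_of_map_eq_gaussianReal hV h (p : ENNReal) (by simp)).integrable_norm_pow'
  simpa using h

theorem one_add_add_pow_le {u v : ℝ} (hu : 0 ≤ u) (hv : 0 ≤ v) (n : ℕ) :
    (1 + u + v) ^ n ≤ 3 ^ n * (1 + u ^ n + v ^ n) := by
  have h : 1 + u + v ≤ 3 * max 1 (max u v) := by
    have h1 := le_max_left 1 (max u v)
    have h2 := (le_max_left u v).trans (le_max_right 1 (max u v))
    have h3 := (le_max_right u v).trans (le_max_right 1 (max u v))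
    linarith
  have hu' : 0 ≤ u ^ n := by positivity
  have hv' : 0 ≤ v ^ n := by positivity
  calc (1 + u + v) ^ n ≤ (3 * max 1 (max u v)) ^ n := by gcongr
    _ = 3 ^ n * (max 1 (max u v)) ^ n := mul_pow _ _ _
    _ ≤ _ := by
      gcongr
      rcases max_choice 1 (max u v) with h | h <;> rw [h]
      · rw [one_pow]; linarith
      · rcases max_choice u v with h | h <;> rw [h] <;> linarith

/-- The quantitative pointwise comparison behind `abs_integral_le_of_gaussian`. -/
theorem abs_reflection_diff_le {K p p' c r U V : ℝ} (hc : 0 ≤ c) (hr : |r| ≤ 1)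
    (hp : |p - p'| ≤ 2 * K ^ 2 * c * |V|) (hp' : |p'| ≤ K ^ 2) :
    |(p * U ^ 5 - p' * (U - 2 * r * V) ^ 5) * V ^ 5| ≤
      162 * K ^ 2 * 3 ^ 11 * (c + |r|) * (1 + |U| ^ 11 + |V| ^ 11) := by
  set w : ℝ := 1 + |U| + |V| with hw
  have hU0 := abs_nonneg U
  have hV0 := abs_nonneg V
  have hw1 : 1 ≤ w := by rw [hw]; linarith
  have hUw : |U| ≤ w := by rw [hw]; linarith
  have hVw : |V| ≤ w := by rw [hw]; linarith
  have hrV : |2 * r * V| ≤ 2 * |r| * w := by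
    rw [abs_mul, abs_mul, abs_of_pos (by norm_num : (0 : ℝ) < 2)]
    gcongr
  have hU' : |U - 2 * r * V| ≤ 2 * w := by
    have h1 := abs_sub U (2 * r * V)
    have h2 : |2 * r * V| ≤ 2 * |V| := by
      rw [abs_mul, abs_mul, abs_of_pos (by norm_num : (0 : ℝ) < 2)]
      nlinarith
    rw [hw]; linarith
  have h5 := abs_pow_five_sub_le (hUw.trans (by linarith : w ≤ 2 * w)) hU'
  rw [show U - (U - 2 * r * V) = 2 * r * V by ring] at h5
  have hfirst : |(p - p') * U ^ 5| ≤ 2 * K ^ 2 * c * w * w ^ 5 := by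
    rw [abs_mul, abs_pow]
    gcongr
    exact hp.trans (by gcongr)
  have hsecond : |p' * (U ^ 5 - (U - 2 * r * V) ^ 5)| ≤
      K ^ 2 * (5 * (2 * w) ^ 4 * (2 * |r| * w)) := by
    rw [abs_mul]
    gcongr
    exact h5.trans (by gcongr)
  calc |(p * U ^ 5 - p' * (U - 2 * r * V) ^ 5) * V ^ 5|
      = |(p - p') * U ^ 5 + p' * (U ^ 5 - (U - 2 * r * V) ^ 5)| * |V| ^ 5 := by
        rw [abs_mul, abs_pow]; congr 2; ring
    _ ≤ (2 * K ^ 2 * c * w * w ^ 5 + K ^ 2 * (5 * (2 * w) ^ 4 * (2 * |r| * w))) * w ^ 5 := by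
        gcongr
        exact (abs_add_le _ _).trans (add_le_add hfirst hsecond)
    _ = 2 * K ^ 2 * c * w ^ 11 + 160 * K ^ 2 * |r| * w ^ 10 := by ring
    _ ≤ 162 * K ^ 2 * c * w ^ 11 + 162 * K ^ 2 * |r| * w ^ 11 := by
        gcongr <;> norm_num
    _ = 162 * K ^ 2 * (c + |r|) * w ^ 11 := by ring
    _ ≤ 162 * K ^ 2 * (c + |r|) * (3 ^ 11 * (1 + |U| ^ 11 + |V| ^ 11)) := by
        gcongr
        exact one_add_add_pow_le hU0 hV0 11
    _ = _ := by ring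

/-- Decorrelation: for a centered Gaussian vector `(X 0, X 1, X 2, X 3)` with normalized last
two coordinates, the weighted fifth powers of the latter are almost uncorrelated when `X 3` is
almost uncorrelated from the other coordinates. -/
theorem abs_integral_le_of_gaussian [IsProbabilityMeasure μ] {X : Fin 4 → Ω → ℝ}
    (hX : ∀ i, Measurable (X i))
    (hG : ∀ a : Fin 4 → ℝ, ∃ v : NNReal, μ.map (fun ω => ∑ i, a i * X i ω) = gaussianReal 0 v)
    (h2 : ∫ ω, X 2 ω ^ 2 ∂μ = 1) (h3 : ∫ ω, X 3 ω ^ 2 ∂μ = 1)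
    {h : ℝ → ℝ} {K : ℝ} (hK : 0 ≤ K) (hb : ∀ x, |h x| ≤ K)
    (hL : ∀ x y, |h x - h y| ≤ K * |x - y|) (hh : Continuous h) :
    |∫ ω, h (X 0 ω) * h (X 1 ω) * (X 2 ω) ^ 5 * (X 3 ω) ^ 5 ∂μ| ≤
      81 * K ^ 2 * 3 ^ 11 * (1 + 2 * gaussMoment 11) *
        (|∫ ω, X 0 ω * X 3 ω ∂μ| + |∫ ω, X 1 ω * X 3 ω ∂μ| + |∫ ω, X 2 ω * X 3 ω ∂μ|) := by
  have hGi : ∀ i, ∃ v : NNReal, μ.map (X i) = gaussianReal 0 v := fun i => by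
    simpa [Pi.single_apply] using hG (Pi.single i 1)
  have hrefl := map_reflection_eq hX hG 3 h3
  set c : Fin 4 → ℝ := fun i => ∫ ω', X i ω' * X 3 ω' ∂μ with hc
  have hc3 : c 3 = 1 := by simpa [hc, pow_two] using h3
  have hL2 : ∀ i, MemLp (X i) 2 μ := fun i =>
    memLp_of_map_eq_gaussianReal (hX i) (hGi i) 2 (by simp)
  have hc2 : |c 2| ≤ 1 := by
    have hs2 := (hL2 2).integrable_sq
    have hs3 := (hL2 3).integrable_sq
    calc |c 2| ≤ ∫ ω, |X 2 ω * X 3 ω| ∂μ := abs_integral_le_integral_abs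
      _ ≤ ∫ ω, (X 2 ω ^ 2 + X 3 ω ^ 2) / 2 ∂μ := by
          refine integral_mono ((hL2 2).integrable_mul (hL2 3)).abs
            ((hs2.add hs3).div_const 2) fun ω => ?_
          simp only
          rw [abs_le]
          constructor <;> nlinarith [sq_nonneg (X 2 ω + X 3 ω), sq_nonneg (X 2 ω - X 3 ω)]
      _ = 1 := by rw [integral_div, integral_add hs2 hs3, h2, h3]; norm_num
  let F : (Fin 4 → ℝ) → ℝ := fun x => h (x 0) * h (x 1) * x 2 ^ 5 * x 3 ^ 5
  have hF : Measurable F := by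
    have := hh.measurable
    fun_prop
  have hX1 : Measurable (fun ω i => X i ω) := measurable_pi_lambda _ hX
  have hX2 : Measurable (fun ω i => X i ω - 2 * c i * X 3 ω) :=
    measurable_pi_lambda _ fun i => (hX i).sub ((hX 3).const_mul _)
  have hFint : Integrable (fun ω => F (fun i => X i ω)) μ := by
    have hdom : Integrable (fun ω => K ^ 2 * (|X 2 ω| ^ 10 + |X 3 ω| ^ 10)) μ :=
      ((integrable_abs_pow_of_gaussian (hX 2) (hGi 2) 10).add
        (integrable_abs_pow_of_gaussian (hX 3) (hGi 3) 10)).const_mul _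
    refine hdom.mono' (hF.comp hX1).aestronglyMeasurable (ae_of_all _ fun ω => ?_)
    simp only [F, Real.norm_eq_abs, abs_mul, abs_pow]
    calc |h (X 0 ω)| * |h (X 1 ω)| * |X 2 ω| ^ 5 * |X 3 ω| ^ 5
        ≤ K * K * |X 2 ω| ^ 5 * |X 3 ω| ^ 5 := by
          gcongr
          · exact hb _
          · exact hb _
      _ ≤ _ := by
          have := sq_nonneg (|X 2 ω| ^ 5 - |X 3 ω| ^ 5)
          have h4 := sq_nonneg (|X 2 ω| ^ 5 + |X 3 ω| ^ 5)
          have : |X 2 ω| ^ 5 * |X 3 ω| ^ 5 ≤ |X 2 ω| ^ 10 + |X 3 ω| ^ 10 := by nlinarith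
          nlinarith [sq_nonneg K]
  have hFmap : ∫ ω, F (fun i => X i ω) ∂μ = ∫ ω, F (fun i => X i ω - 2 * c i * X 3 ω) ∂μ := by
    rw [← integral_map hX1.aemeasurable hF.aestronglyMeasurable, hrefl,
      integral_map hX2.aemeasurable hF.aestronglyMeasurable]
  have hFint2 : Integrable (fun ω => F (fun i => X i ω - 2 * c i * X 3 ω)) μ := by
    have h1 := (integrable_map_measure hF.aestronglyMeasurable hX1.aemeasurable).2 hFint
    rw [hrefl] at h1
    exact (integrable_map_measure hF.aestronglyMeasurable hX2.aemeasurable).1 h1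
  have hm2 := integral_abs_pow_eq_gaussMoment (hX 2) (map_eq_standard (hX 2) (hGi 2) h2) 11
  have hm3 := integral_abs_pow_eq_gaussMoment (hX 3) (map_eq_standard (hX 3) (hGi 3) h3) 11
  have hi2 := integrable_abs_pow_of_gaussian (hX 2) (hGi 2) 11
  have hi3 := integrable_abs_pow_of_gaussian (hX 3) (hGi 3) 11
  have key : |∫ ω, (F (fun i => X i ω) + F (fun i => X i ω - 2 * c i * X 3 ω)) ∂μ| ≤
      ∫ ω, 162 * K ^ 2 * 3 ^ 11 * (|c 0| + |c 1| + |c 2|) *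
        (1 + |X 2 ω| ^ 11 + |X 3 ω| ^ 11) ∂μ := by
    refine abs_integral_le_integral_abs.trans (integral_mono (hFint.add hFint2).abs
      ((((integrable_const 1).add hi2).add hi3).const_mul _) fun ω => ?_)
    have hdiff : ∀ i, |h (X i ω) - h (X i ω - 2 * c i * X 3 ω)| ≤ K * (2 * |c i| * |X 3 ω|) := by
      intro i
      refine (hL _ _).trans_eq ?_
      rw [show X i ω - (X i ω - 2 * c i * X 3 ω) = 2 * c i * X 3 ω by ring, abs_mul, abs_mul,
        abs_of_pos (by norm_num : (0 : ℝ) < 2)]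
    have hp : |h (X 0 ω) * h (X 1 ω) -
        h (X 0 ω - 2 * c 0 * X 3 ω) * h (X 1 ω - 2 * c 1 * X 3 ω)| ≤
        2 * K ^ 2 * (|c 0| + |c 1|) * |X 3 ω| := by
      calc _ = |(h (X 0 ω) - h (X 0 ω - 2 * c 0 * X 3 ω)) * h (X 1 ω) +
            h (X 0 ω - 2 * c 0 * X 3 ω) * (h (X 1 ω) - h (X 1 ω - 2 * c 1 * X 3 ω))| := by
            congr 1; ring
        _ ≤ K * (2 * |c 0| * |X 3 ω|) * K + K * (K * (2 * |c 1| * |X 3 ω|)) := by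
            refine (abs_add_le _ _).trans ?_
            rw [abs_mul, abs_mul]
            gcongr
            · exact hdiff 0
            · exact hb _
            · exact hb _
            · exact hdiff 1
        _ = _ := by ring
    have hp' : |h (X 0 ω - 2 * c 0 * X 3 ω) * h (X 1 ω - 2 * c 1 * X 3 ω)| ≤ K ^ 2 := by
      rw [abs_mul, pow_two]
      gcongr
      · exact hb _
      · exact hb _
    refine le_of_eq_of_le ?_ (abs_reflection_diff_le (U := X 2 ω) (V := X 3 ω)
      (by positivity) hc2 hp hp')
    simp only [F, hc3]
    congr 1
    ring
  have h12 : Integrable (fun ω => 1 + |X 2 ω| ^ 11) μ := (integrable_const 1).add hi2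
  rw [integral_add hFint hFint2, ← hFmap, integral_const_mul,
    integral_add h12 hi3, integral_add (integrable_const 1) hi2,
    hm2, hm3] at key
  simp only [integral_const, probReal_univ, smul_eq_mul, mul_one] at key
  change |∫ ω, F (fun i => X i ω) ∂μ| ≤ 81 * K ^ 2 * 3 ^ 11 * (1 + 2 * gaussMoment 11) *
    (|c 0| + |c 1| + |c 2|)
  rw [← two_mul, abs_mul, abs_of_pos (by norm_num : (0 : ℝ) < 2)] at key
  linarith

end Gaussian

/-- The odd extension of the cube root. -/
def signedCbrt (x : ℝ) : ℝ := if 0 ≤ x then x ^ ((1 : ℝ) / 3) else -(-x) ^ ((1 : ℝ) / 3)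

theorem signedCbrt_of_nonneg {x : ℝ} (hx : 0 ≤ x) : signedCbrt x = x ^ ((1 : ℝ) / 3) :=
  if_pos hx

theorem signedCbrt_of_nonpos {x : ℝ} (hx : x ≤ 0) : signedCbrt x = -(-x) ^ ((1 : ℝ) / 3) := by
  rcases hx.lt_or_eq with h | h
  · exact if_neg h.not_ge
  · rw [signedCbrt, if_pos h.ge, h]
    norm_num

theorem abs_signedCbrt_le {x a : ℝ} (h : |x| ≤ a) : |signedCbrt x| ≤ a ^ ((1 : ℝ) / 3) := by
  have h0 : |signedCbrt x| = |x| ^ ((1 : ℝ) / 3) := by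
    rcases le_total 0 x with hx | hx
    · rw [signedCbrt_of_nonneg hx, abs_of_nonneg hx, abs_of_nonneg (by positivity)]
    · rw [signedCbrt_of_nonpos hx, abs_of_nonpos hx, abs_neg,
        abs_of_nonneg (Real.rpow_nonneg (by linarith) _)]
  rw [h0]
  exact Real.rpow_le_rpow (abs_nonneg x) h (by norm_num)

/-- Increment of the odd cube root over `[x, x + 1]`. -/
def cbrtStep (x : ℝ) : ℝ := signedCbrt (x + 1) - signedCbrt x

theorem abs_abs_rpow_sub_eq_cbrtStep (z : ℤ) :
    |(|(z : ℝ) + 1| ^ ((1 : ℝ) / 3) - |(z : ℝ)| ^ ((1 : ℝ) / 3))| = cbrtStep z := by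
  rw [cbrtStep]
  rcases le_or_gt 0 z with hz | hz
  · have hz' : (0 : ℝ) ≤ z := by exact_mod_cast hz
    rw [signedCbrt_of_nonneg hz', signedCbrt_of_nonneg (by linarith), abs_of_nonneg hz',
      abs_of_nonneg (by linarith : (0 : ℝ) ≤ z + 1), abs_of_nonneg]
    rw [sub_nonneg]
    exact Real.rpow_le_rpow hz' (by linarith) (by norm_num)
  · have hz' : (z : ℝ) + 1 ≤ 0 := by exact_mod_cast hz
    rw [signedCbrt_of_nonpos hz', signedCbrt_of_nonpos (by linarith), abs_of_nonpos hz',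
      abs_of_nonpos (by linarith : (z : ℝ) ≤ 0), abs_of_nonpos]
    · ring
    · rw [sub_nonpos]
      exact Real.rpow_le_rpow (by linarith) (by linarith) (by norm_num)

theorem cbrtStep_nonneg (z : ℤ) : 0 ≤ cbrtStep z := by
  rw [← abs_abs_rpow_sub_eq_cbrtStep]
  exact abs_nonneg _

theorem sum_cbrtStep_le (N : ℕ) (x : ℝ) (h1 : |x| ≤ N) (h2 : |x + N| ≤ N) :
    ∑ k ∈ Finset.range N, cbrtStep (x + k) ≤ 2 * (N : ℝ) ^ ((1 : ℝ) / 3) := by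
  have h : ∑ k ∈ Finset.range N, cbrtStep (x + k) = signedCbrt (x + N) - signedCbrt x := by
    have h := Finset.sum_range_sub (fun k : ℕ => signedCbrt (x + k)) N
    simp only [Nat.cast_zero, add_zero, Nat.cast_add, Nat.cast_one, ← add_assoc] at h
    exact h
  rw [h]
  have h3 := abs_le.1 (abs_signedCbrt_le h1)
  have h4 := abs_le.1 (abs_signedCbrt_le h2)
  linarith [h3.1, h4.2]

/-- The bound, up to a constant, on the correlations between the increment with index `j` and
the increment and midpoint with index `k`. -/
def corrBound (j k : ℕ) : ℝ :=
  cbrtStep j + cbrtStep ((k : ℝ) - j) + cbrtStep ((k : ℝ) - j - 1)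

theorem sum_corrBound_le (N : ℕ) :
    ∑ j ∈ Finset.range N, ∑ k ∈ Finset.range N, corrBound j k ≤
      6 * (N * (N : ℝ) ^ ((1 : ℝ) / 3)) := by
  have hN : (0 : ℝ) ≤ N := Nat.cast_nonneg N
  have hj : ∑ j ∈ Finset.range N, cbrtStep (j : ℝ) ≤ 2 * (N : ℝ) ^ ((1 : ℝ) / 3) := by
    simpa using sum_cbrtStep_le N 0 (by simp) (by simp)
  have hinner : ∀ j ∈ Finset.range N, ∑ k ∈ Finset.range N, corrBound j k ≤
      N * cbrtStep j + 4 * (N : ℝ) ^ ((1 : ℝ) / 3) := by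
    intro j hj
    have hjN : (j : ℝ) + 1 ≤ N := by exact_mod_cast Finset.mem_range.1 hj
    have hj0 : (0 : ℝ) ≤ j := Nat.cast_nonneg j
    have h1 := sum_cbrtStep_le N (-(j : ℝ)) (by rw [abs_le]; constructor <;> linarith)
      (by rw [abs_le]; constructor <;> linarith)
    have h2 := sum_cbrtStep_le N (-(j : ℝ) - 1) (by rw [abs_le]; constructor <;> linarith)
      (by rw [abs_le]; constructor <;> linarith)
    have e1 : ∀ k : ℕ, (k : ℝ) - j = -(j : ℝ) + k := fun k => by ring
    have e2 : ∀ k : ℕ, -(j : ℝ) + k - 1 = -(j : ℝ) - 1 + k := fun k => by ring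
    simp only [corrBound, Finset.sum_add_distrib, Finset.sum_const, Finset.card_range,
      nsmul_eq_mul, e1, e2]
    linarith
  calc _ ≤ ∑ j ∈ Finset.range N, (N * cbrtStep j + 4 * (N : ℝ) ^ ((1 : ℝ) / 3)) :=
        Finset.sum_le_sum hinner
    _ = N * ∑ j ∈ Finset.range N, cbrtStep j + N * (4 * (N : ℝ) ^ ((1 : ℝ) / 3)) := by
        simp [Finset.sum_add_distrib, Finset.mul_sum]
    _ ≤ N * (2 * (N : ℝ) ^ ((1 : ℝ) / 3)) + N * (4 * (N : ℝ) ^ ((1 : ℝ) / 3)) := by gcongr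
    _ = _ := by ring

section FBM

variable {Ω : Type*}

/-- The increment of `B` over the `j`-th interval of the mesh `1 / n`. -/
def meshIncr (B : ℝ → Ω → ℝ) (n j : ℕ) (ω : Ω) : ℝ :=
  B (((j : ℝ) + 1) / n) ω - B ((j : ℝ) / n) ω

/-- The average of the values of `B` at the ends of the `j`-th interval of the mesh `1 / n`. -/
def meshMid (B : ℝ → Ω → ℝ) (n j : ℕ) (ω : Ω) : ℝ :=
  (B ((j : ℝ) / n) ω + B (((j : ℝ) + 1) / n) ω) / 2

variable [MeasureSpace Ω] {B : ℝ → Ω → ℝ}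

theorem IsFBM16.measurable_meshIncr (hB : IsFBM16 B) (n j : ℕ) : Measurable (meshIncr B n j) :=
  (hB.1 _).sub (hB.1 _)

theorem IsFBM16.measurable_meshMid (hB : IsFBM16 B) (n j : ℕ) : Measurable (meshMid B n j) :=
  ((hB.1 _).add (hB.1 _)).div_const 2

theorem IsFBM16.integrable_mul (hB : IsFBM16 B) {s t : ℝ} (hs : 0 ≤ s) (ht : 0 ≤ t) :
    Integrable (fun ω => B s ω * B t ω) := by
  have h : ∀ u : ℝ, 0 ≤ u → MemLp (B u) 2 := fun u hu =>
    memLp_of_map_eq_gaussianReal (hB.1 u)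
      (by simpa using hB.2.2.1 1 (fun _ => u) (fun _ => 1) fun _ => hu) 2 (by simp)
  exact (h s hs).integrable_mul (h t ht)

theorem IsFBM16.integral_mesh_mul (hB : IsFBM16 B) (n : ℕ) (x y : ℝ) (hx : 0 ≤ x) (hy : 0 ≤ y) :
    ∫ ω, B (x / n) ω * B (y / n) ω =
      ((n : ℝ) ^ ((1 : ℝ) / 3))⁻¹ *
        ((x ^ ((1 : ℝ) / 3) + y ^ ((1 : ℝ) / 3) - |x - y| ^ ((1 : ℝ) / 3)) / 2) := by
  have hn : (0 : ℝ) ≤ n := Nat.cast_nonneg n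
  rw [hB.2.2.2 _ _ (by positivity) (by positivity), ← sub_div, abs_div, abs_of_nonneg hn,
    Real.div_rpow hx hn, Real.div_rpow hy hn, Real.div_rpow (abs_nonneg _) hn, abs_sub_comm y x]
  ring

theorem IsFBM16.integral_meshIncr_mul (hB : IsFBM16 B) (n j k : ℕ) :
    ∫ ω, meshIncr B n k ω * meshIncr B n j ω =
      ((n : ℝ) ^ ((1 : ℝ) / 3))⁻¹ *
        ((|(k : ℝ) - j + 1| ^ ((1 : ℝ) / 3) + |(k : ℝ) - j - 1| ^ ((1 : ℝ) / 3)
          - 2 * |(k : ℝ) - j| ^ ((1 : ℝ) / 3)) / 2) := by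
  have p0 : ∀ i : ℕ, (0 : ℝ) ≤ (i : ℝ) := fun i => Nat.cast_nonneg i
  have p1 : ∀ i : ℕ, (0 : ℝ) ≤ (i : ℝ) + 1 := fun i => by positivity
  have I : ∀ {x y : ℝ}, 0 ≤ x → 0 ≤ y → Integrable (fun ω => B (x / n) ω * B (y / n) ω) :=
    fun hx hy => hB.integrable_mul (by positivity) (by positivity)
  have J : ∀ {x y z : ℝ}, 0 ≤ x → 0 ≤ y → 0 ≤ z →
      Integrable (fun ω => B (x / n) ω * B (y / n) ω - B (x / n) ω * B (z / n) ω) :=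
    fun hx hy hz => (I hx hy).sub (I hx hz)
  have e : (fun ω => meshIncr B n k ω * meshIncr B n j ω) = fun ω =>
      (B (((k : ℝ) + 1) / n) ω * B (((j : ℝ) + 1) / n) ω -
        B (((k : ℝ) + 1) / n) ω * B ((j : ℝ) / n) ω)
      - (B ((k : ℝ) / n) ω * B (((j : ℝ) + 1) / n) ω - B ((k : ℝ) / n) ω * B ((j : ℝ) / n) ω) := by
    ext ω; simp only [meshIncr]; ring
  rw [e, integral_sub (J (p1 k) (p1 j) (p0 j)) (J (p0 k) (p1 j) (p0 j)),
    integral_sub (I (p1 k) (p1 j)) (I (p1 k) (p0 j)),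
    integral_sub (I (p0 k) (p1 j)) (I (p0 k) (p0 j)),
    hB.integral_mesh_mul n _ _ (p1 k) (p1 j), hB.integral_mesh_mul n _ _ (p1 k) (p0 j),
    hB.integral_mesh_mul n _ _ (p0 k) (p1 j), hB.integral_mesh_mul n _ _ (p0 k) (p0 j),
    show (k : ℝ) + 1 - (j + 1) = k - j by ring, show (k : ℝ) + 1 - j = k - j + 1 by ring,
    show (k : ℝ) - (j + 1) = k - j - 1 by ring]
  ring

theorem IsFBM16.integral_meshMid_mul (hB : IsFBM16 B) (n j k : ℕ) :
    ∫ ω, meshMid B n k ω * meshIncr B n j ω =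
      ((n : ℝ) ^ ((1 : ℝ) / 3))⁻¹ *
        ((((j : ℝ) + 1) ^ ((1 : ℝ) / 3) - (j : ℝ) ^ ((1 : ℝ) / 3)) / 2 +
          (|(k : ℝ) - j + 1| ^ ((1 : ℝ) / 3) - |(k : ℝ) - j - 1| ^ ((1 : ℝ) / 3)) / 4) := by
  have p0 : ∀ i : ℕ, (0 : ℝ) ≤ (i : ℝ) := fun i => Nat.cast_nonneg i
  have p1 : ∀ i : ℕ, (0 : ℝ) ≤ (i : ℝ) + 1 := fun i => by positivity
  have I : ∀ {x y : ℝ}, 0 ≤ x → 0 ≤ y → Integrable (fun ω => B (x / n) ω * B (y / n) ω) :=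
    fun hx hy => hB.integrable_mul (by positivity) (by positivity)
  have J : ∀ {x y z : ℝ}, 0 ≤ x → 0 ≤ y → 0 ≤ z →
      Integrable (fun ω => B (x / n) ω * B (y / n) ω - B (x / n) ω * B (z / n) ω) :=
    fun hx hy hz => (I hx hy).sub (I hx hz)
  have e : (fun ω => meshMid B n k ω * meshIncr B n j ω) = fun ω => (2 : ℝ)⁻¹ *
      ((B (((k : ℝ) + 1) / n) ω * B (((j : ℝ) + 1) / n) ω -
        B (((k : ℝ) + 1) / n) ω * B ((j : ℝ) / n) ω)
      + (B ((k : ℝ) / n) ω * B (((j : ℝ) + 1) / n) ω - B ((k : ℝ) / n) ω * B ((j : ℝ) / n) ω)) := by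
    ext ω; simp only [meshIncr, meshMid]; ring
  rw [e, integral_const_mul, integral_add (J (p1 k) (p1 j) (p0 j)) (J (p0 k) (p1 j) (p0 j)),
    integral_sub (I (p1 k) (p1 j)) (I (p1 k) (p0 j)),
    integral_sub (I (p0 k) (p1 j)) (I (p0 k) (p0 j)),
    hB.integral_mesh_mul n _ _ (p1 k) (p1 j), hB.integral_mesh_mul n _ _ (p1 k) (p0 j),
    hB.integral_mesh_mul n _ _ (p0 k) (p1 j), hB.integral_mesh_mul n _ _ (p0 k) (p0 j),
    show (k : ℝ) + 1 - (j + 1) = k - j by ring, show (k : ℝ) + 1 - j = k - j + 1 by ring,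
    show (k : ℝ) - (j + 1) = k - j - 1 by ring]
  ring

theorem abs_sq_mul_integral_meshIncr_mul_le (hB : IsFBM16 B) {n : ℕ} (hn : 0 < n) (j k : ℕ) :
    |(n : ℝ) ^ ((1 : ℝ) / 3) * ∫ ω, meshIncr B n k ω * meshIncr B n j ω| ≤ corrBound j k := by
  have hq : (0 : ℝ) < (n : ℝ) ^ ((1 : ℝ) / 3) := by positivity
  rw [hB.integral_meshIncr_mul, mul_inv_cancel_left₀ hq.ne', corrBound]
  have h1 := abs_abs_rpow_sub_eq_cbrtStep ((k : ℤ) - j)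
  have h2 := abs_abs_rpow_sub_eq_cbrtStep ((k : ℤ) - j - 1)
  have h3 := cbrtStep_nonneg j
  have h4 := cbrtStep_nonneg ((k : ℤ) - j)
  have h5 := cbrtStep_nonneg ((k : ℤ) - j - 1)
  push_cast at h1 h2 h3 h4 h5
  rw [sub_add_cancel] at h2
  have h1 := abs_le.1 h1.le
  have h2 := abs_le.1 h2.le
  rw [abs_le]
  constructor <;> linarith [h1.1, h1.2, h2.1, h2.2]

theorem abs_mul_integral_meshMid_mul_le (hB : IsFBM16 B) {n : ℕ} (hn : 0 < n) (j k : ℕ) :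
    |(n : ℝ) ^ ((1 : ℝ) / 6) * ∫ ω, meshMid B n k ω * meshIncr B n j ω| ≤ corrBound j k := by
  have hn1 : (1 : ℝ) ≤ n := by exact_mod_cast hn
  have hq : (0 : ℝ) < (n : ℝ) ^ ((1 : ℝ) / 3) := by positivity
  have hq' : (n : ℝ) ^ ((1 : ℝ) / 6) * ((n : ℝ) ^ ((1 : ℝ) / 3))⁻¹ ≤ 1 := by
    rw [← div_eq_mul_inv, div_le_one hq]
    exact Real.rpow_le_rpow_of_exponent_le hn1 (by norm_num)
  rw [hB.integral_meshMid_mul, ← mul_assoc, abs_mul, abs_of_nonneg (by positivity), corrBound]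
  refine (mul_le_mul_of_nonneg_right hq' (abs_nonneg _)).trans ?_
  rw [one_mul]
  have h0 := abs_abs_rpow_sub_eq_cbrtStep j
  have h1 := abs_abs_rpow_sub_eq_cbrtStep ((k : ℤ) - j)
  have h2 := abs_abs_rpow_sub_eq_cbrtStep ((k : ℤ) - j - 1)
  have h3 := cbrtStep_nonneg j
  have h4 := cbrtStep_nonneg ((k : ℤ) - j)
  have h5 := cbrtStep_nonneg ((k : ℤ) - j - 1)
  push_cast at h0 h1 h2 h3 h4 h5
  rw [sub_add_cancel] at h2
  rw [abs_of_nonneg (by positivity : (0 : ℝ) ≤ (j : ℝ) + 1),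
    abs_of_nonneg (Nat.cast_nonneg j : (0 : ℝ) ≤ j)] at h0
  have h0 := abs_le.1 h0.le
  have h1 := abs_le.1 h1.le
  have h2 := abs_le.1 h2.le
  rw [abs_le]
  constructor <;> linarith [h0.1, h0.2, h1.1, h1.2, h2.1, h2.2]

theorem abs_mul_integral_meshMid_mul_self_le (hB : IsFBM16 B) {n : ℕ} (hn : 0 < n) (j k : ℕ) :
    |(n : ℝ) ^ ((1 : ℝ) / 6) * ∫ ω, meshMid B n j ω * meshIncr B n j ω| ≤ corrBound j k := by
  have hn1 : (1 : ℝ) ≤ n := by exact_mod_cast hn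
  have hq : (0 : ℝ) < (n : ℝ) ^ ((1 : ℝ) / 3) := by positivity
  have hq' : (n : ℝ) ^ ((1 : ℝ) / 6) * ((n : ℝ) ^ ((1 : ℝ) / 3))⁻¹ ≤ 1 := by
    rw [← div_eq_mul_inv, div_le_one hq]
    exact Real.rpow_le_rpow_of_exponent_le hn1 (by norm_num)
  rw [hB.integral_meshMid_mul, ← mul_assoc, abs_mul, abs_of_nonneg (by positivity), corrBound]
  refine (mul_le_mul_of_nonneg_right hq' (abs_nonneg _)).trans ?_
  rw [one_mul, sub_self, zero_add, zero_sub, abs_neg, sub_self, zero_div, add_zero]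
  have h0 := abs_abs_rpow_sub_eq_cbrtStep j
  have h3 := cbrtStep_nonneg j
  have h4 := cbrtStep_nonneg ((k : ℤ) - j)
  have h5 := cbrtStep_nonneg ((k : ℤ) - j - 1)
  push_cast at h0 h3 h4 h5
  rw [abs_of_nonneg (by positivity : (0 : ℝ) ≤ (j : ℝ) + 1),
    abs_of_nonneg (Nat.cast_nonneg j : (0 : ℝ) ≤ j)] at h0
  have h0 := abs_le.1 h0.le
  rw [abs_le]
  constructor <;> linarith [h0.1, h0.2]

theorem integral_mul_meshIncr_sq (hB : IsFBM16 B) {n : ℕ} (hn : 0 < n) (j : ℕ) :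
    ∫ ω, ((n : ℝ) ^ ((1 : ℝ) / 6) * meshIncr B n j ω) ^ 2 = 1 := by
  have hq : (0 : ℝ) < (n : ℝ) ^ ((1 : ℝ) / 3) := by positivity
  have hs : ((n : ℝ) ^ ((1 : ℝ) / 6)) ^ 2 = (n : ℝ) ^ ((1 : ℝ) / 3) := by
    rw [← Real.rpow_natCast, ← Real.rpow_mul (Nat.cast_nonneg n)]
    norm_num
  simp only [mul_pow, hs]
  rw [integral_const_mul]
  simp only [pow_two]
  rw [hB.integral_meshIncr_mul, mul_inv_cancel_left₀ hq.ne']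
  norm_num

theorem mul_meshIncr_standard (hB : IsFBM16 B) {n : ℕ} (hn : 0 < n) (j : ℕ) :
    Measure.map (fun ω => (n : ℝ) ^ ((1 : ℝ) / 6) * meshIncr B n j ω) volume =
      gaussianReal 0 1 := by
  refine map_eq_standard ((hB.measurable_meshIncr n j).const_mul _) ?_
    (integral_mul_meshIncr_sq hB hn j)
  obtain ⟨v, hv⟩ := hB.2.2.1 2 ![((j : ℝ) + 1) / n, (j : ℝ) / n]
    ![(n : ℝ) ^ ((1 : ℝ) / 6), -(n : ℝ) ^ ((1 : ℝ) / 6)] (by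
      intro i; fin_cases i
      · exact div_nonneg (by positivity) (Nat.cast_nonneg n)
      · exact div_nonneg (Nat.cast_nonneg j) (Nat.cast_nonneg n))
  refine ⟨v, ?_⟩
  rw [← hv]
  congr 1
  ext ω
  simp [meshIncr]
  ring

theorem integral_abs_meshIncr_pow (hB : IsFBM16 B) {n : ℕ} (hn : 0 < n) (j p : ℕ) :
    ∫ ω, |meshIncr B n j ω| ^ p = gaussMoment p * (n : ℝ) ^ (-(p : ℝ) / 6) := by
  have hq : (0 : ℝ) < (n : ℝ) ^ ((1 : ℝ) / 6) := by positivity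
  have h := integral_abs_pow_eq_gaussMoment ((hB.measurable_meshIncr n j).const_mul _)
    (mul_meshIncr_standard hB hn j) p
  simp only [abs_mul, mul_pow, abs_of_pos hq] at h
  rw [integral_const_mul, ← Real.rpow_natCast, ← Real.rpow_mul (Nat.cast_nonneg n)] at h
  rw [← h, mul_comm, ← mul_assoc, ← Real.rpow_add (by positivity)]
  ring_nf
  simp

theorem integrable_abs_meshIncr_pow [IsProbabilityMeasure (volume : Measure Ω)] (hB : IsFBM16 B)
    {n : ℕ} (hn : 0 < n) (j p : ℕ) : Integrable (fun ω => |meshIncr B n j ω| ^ p) := by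
  have hq : (0 : ℝ) < (n : ℝ) ^ ((1 : ℝ) / 6) := by positivity
  have h := integrable_abs_pow_of_gaussian ((hB.measurable_meshIncr n j).const_mul _)
    ⟨1, mul_meshIncr_standard hB hn j⟩ p
  simp only [abs_mul, mul_pow] at h
  exact (integrable_const_mul_iff (IsUnit.mk0 _ (by positivity)) _).1 h

end FBM

section SecondMoment

variable {Ω : Type*} [MeasureSpace Ω] {B : ℝ → Ω → ℝ}

theorem exists_map_mesh_eq_gaussianReal (hB : IsFBM16 B) (n j k : ℕ) (q : ℝ) (a : Fin 4 → ℝ) :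
    ∃ v : NNReal, Measure.map (fun ω => ∑ i, a i *
      (![meshMid B n j, meshMid B n k, fun ω => q * meshIncr B n k ω,
        fun ω => q * meshIncr B n j ω] : Fin 4 → Ω → ℝ) i ω) volume = gaussianReal 0 v := by
  obtain ⟨v, hv⟩ := hB.2.2.1 4
    ![(j : ℝ) / n, ((j : ℝ) + 1) / n, (k : ℝ) / n, ((k : ℝ) + 1) / n]
    ![a 0 / 2 - q * a 3, a 0 / 2 + q * a 3, a 1 / 2 - q * a 2, a 1 / 2 + q * a 2] (by
      simp only [Fin.forall_fin_succ, Matrix.cons_val_zero, Matrix.cons_val_succ]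
      refine ⟨by positivity, by positivity, by positivity, by positivity, ?_⟩
      exact fun i => i.elim0)
  refine ⟨v, ?_⟩
  rw [← hv]
  congr 1
  ext ω
  simp [Fin.sum_univ_four, meshIncr, meshMid]
  ring

/-- The fifth power of the increment, weighted by a function of the midpoint. -/
def fifthTerm (h : ℝ → ℝ) (B : ℝ → Ω → ℝ) (n j : ℕ) (ω : Ω) : ℝ :=
  h (meshMid B n j ω) * meshIncr B n j ω ^ 5

variable {h : ℝ → ℝ} {K : ℝ}

theorem measurable_fifthTerm (hB : IsFBM16 B) (hh : Continuous h) (n j : ℕ) :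
    Measurable (fifthTerm h B n j) :=
  (hh.measurable.comp (hB.measurable_meshMid n j)).mul ((hB.measurable_meshIncr n j).pow_const 5)

variable [IsProbabilityMeasure (volume : Measure Ω)]

theorem integrable_fifthTerm_mul (hB : IsFBM16 B) (hb : ∀ x, |h x| ≤ K)
    (hh : Continuous h) {n : ℕ} (hn : 0 < n) (j k : ℕ) :
    Integrable (fun ω => fifthTerm h B n j ω * fifthTerm h B n k ω) := by
  refine Integrable.mono' (((integrable_abs_meshIncr_pow hB hn j 10).add
    (integrable_abs_meshIncr_pow hB hn k 10)).const_mul (K ^ 2))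
    ((measurable_fifthTerm hB hh n j).mul (measurable_fifthTerm hB hh n k)).aestronglyMeasurable
    (ae_of_all _ fun ω => ?_)
  have e : ‖fifthTerm h B n j ω * fifthTerm h B n k ω‖ =
      (|h (meshMid B n j ω)| * |h (meshMid B n k ω)|) *
        (|meshIncr B n j ω| ^ 5 * |meshIncr B n k ω| ^ 5) := by
    simp only [fifthTerm, Real.norm_eq_abs, abs_mul, abs_pow]
    ring
  have h1 : |h (meshMid B n j ω)| * |h (meshMid B n k ω)| ≤ K ^ 2 := by
    rw [pow_two]
    exact mul_le_mul (hb _) (hb _) (abs_nonneg _) ((abs_nonneg _).trans (hb 0))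
  have h2 : |meshIncr B n j ω| ^ 5 * |meshIncr B n k ω| ^ 5 ≤
      |meshIncr B n j ω| ^ 10 + |meshIncr B n k ω| ^ 10 := by
    nlinarith [sq_nonneg (|meshIncr B n j ω| ^ 5 - |meshIncr B n k ω| ^ 5),
      pow_nonneg (abs_nonneg (meshIncr B n j ω)) 10, pow_nonneg (abs_nonneg (meshIncr B n k ω)) 10]
  rw [e]
  exact mul_le_mul h1 h2 (by positivity) (by positivity)

/-- The constant in the bound on the second moment of sums of `fifthTerm`. -/
def secondMomentConst (K : ℝ) : ℝ := 81 * K ^ 2 * 3 ^ 11 * (1 + 2 * gaussMoment 11)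

theorem secondMomentConst_nonneg (K : ℝ) : 0 ≤ secondMomentConst K := by
  have := gaussMoment_nonneg 11
  unfold secondMomentConst
  positivity

theorem abs_integral_fifthTerm_mul_le (hB : IsFBM16 B) (hb : ∀ x, |h x| ≤ K)
    (hL : ∀ x y, |h x - h y| ≤ K * |x - y|) (hh : Continuous h) {n : ℕ} (hn : 0 < n) (j k : ℕ) :
    |∫ ω, fifthTerm h B n j ω * fifthTerm h B n k ω| ≤
      (n : ℝ) ^ (-(5 : ℝ) / 3) * (secondMomentConst K * (3 * corrBound j k)) := by
  set q : ℝ := (n : ℝ) ^ ((1 : ℝ) / 6) with hq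
  have hn0 : (0 : ℝ) ≤ n := Nat.cast_nonneg n
  have hq2 : q * q = (n : ℝ) ^ ((1 : ℝ) / 3) := by
    rw [hq, ← Real.rpow_add (by positivity)]; norm_num
  have hq10 : q ^ 10 = (n : ℝ) ^ ((5 : ℝ) / 3) := by
    rw [hq, ← Real.rpow_natCast, ← Real.rpow_mul hn0]; norm_num
  have hstd : ∀ i : ℕ, ∫ ω, (q * meshIncr B n i ω) ^ 2 = 1 :=
    integral_mul_meshIncr_sq hB hn
  have main := abs_integral_le_of_gaussian (μ := (volume : Measure Ω))
    (X := ![meshMid B n j, meshMid B n k, fun ω => q * meshIncr B n k ω,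
      fun ω => q * meshIncr B n j ω]) (by
      simp only [Fin.forall_fin_succ, Matrix.cons_val_zero, Matrix.cons_val_succ]
      exact ⟨hB.measurable_meshMid n j, hB.measurable_meshMid n k,
        (hB.measurable_meshIncr n k).const_mul q, (hB.measurable_meshIncr n j).const_mul q,
        fun i => i.elim0⟩)
    (exists_map_mesh_eq_gaussianReal hB n j k q) (hstd k) (hstd j)
    ((abs_nonneg _).trans (hb 0)) hb hL hh
  change |∫ ω, h (meshMid B n j ω) * h (meshMid B n k ω) * (q * meshIncr B n k ω) ^ 5 *
    (q * meshIncr B n j ω) ^ 5| ≤ secondMomentConst K *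
      (|∫ ω, meshMid B n j ω * (q * meshIncr B n j ω)| +
      |∫ ω, meshMid B n k ω * (q * meshIncr B n j ω)| +
      |∫ ω, q * meshIncr B n k ω * (q * meshIncr B n j ω)|) at main
  have e0 : ∀ i, ∫ ω, meshMid B n i ω * (q * meshIncr B n j ω) =
      q * ∫ ω, meshMid B n i ω * meshIncr B n j ω := fun i => by
    rw [← integral_const_mul]; congr 1; ext ω; ring
  have e1 : ∫ ω, q * meshIncr B n k ω * (q * meshIncr B n j ω) =
      (n : ℝ) ^ ((1 : ℝ) / 3) * ∫ ω, meshIncr B n k ω * meshIncr B n j ω := by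
    rw [← integral_const_mul, ← hq2]; congr 1; ext ω; ring
  have e2 : ∫ ω, h (meshMid B n j ω) * h (meshMid B n k ω) * (q * meshIncr B n k ω) ^ 5 *
      (q * meshIncr B n j ω) ^ 5 =
      (n : ℝ) ^ ((5 : ℝ) / 3) * ∫ ω, fifthTerm h B n j ω * fifthTerm h B n k ω := by
    rw [← integral_const_mul, ← hq10]; congr 1; ext ω; simp only [fifthTerm]; ring
  rw [e0, e0, e1, e2, abs_mul, abs_of_nonneg (by positivity : (0 : ℝ) ≤ (n : ℝ) ^ ((5 : ℝ) / 3))]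
    at main
  have hsum := add_le_add (add_le_add (abs_mul_integral_meshMid_mul_self_le hB hn j k)
    (abs_mul_integral_meshMid_mul_le hB hn j k)) (abs_sq_mul_integral_meshIncr_mul_le hB hn j k)
  have main := main.trans (mul_le_mul_of_nonneg_left hsum (secondMomentConst_nonneg K))
  have hp : (0 : ℝ) < (n : ℝ) ^ ((5 : ℝ) / 3) := by positivity
  rw [neg_div, Real.rpow_neg hn0, ← div_eq_inv_mul, le_div_iff₀' hp]
  refine main.trans (le_of_eq ?_)
  ring

theorem integral_sum_fifthTerm_sq_le (hB : IsFBM16 B) (hb : ∀ x, |h x| ≤ K)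
    (hL : ∀ x y, |h x - h y| ≤ K * |x - y|) (hh : Continuous h) {n : ℕ} (hn : 0 < n) (N : ℕ) :
    Integrable (fun ω => (∑ j ∈ Finset.range N, fifthTerm h B n j ω) ^ 2) ∧
    ∫ ω, (∑ j ∈ Finset.range N, fifthTerm h B n j ω) ^ 2 ≤
      18 * secondMomentConst K * (n : ℝ) ^ (-(5 : ℝ) / 3) * (N * (N : ℝ) ^ ((1 : ℝ) / 3)) := by
  have e : (fun ω => (∑ j ∈ Finset.range N, fifthTerm h B n j ω) ^ 2) = fun ω =>
      ∑ j ∈ Finset.range N, ∑ k ∈ Finset.range N, fifthTerm h B n j ω * fifthTerm h B n k ω := by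
    ext ω
    rw [pow_two, Finset.sum_mul_sum]
  have I := integrable_fifthTerm_mul hB hb hh hn
  rw [e]
  refine ⟨integrable_finsetSum _ fun j _ => integrable_finsetSum _ fun k _ => I j k, ?_⟩
  rw [integral_finsetSum _ fun j _ => integrable_finsetSum _ fun k _ => I j k]
  simp_rw [integral_finsetSum _ fun k _ => I _ k]
  calc _ ≤ ∑ j ∈ Finset.range N, ∑ k ∈ Finset.range N,
        (n : ℝ) ^ (-(5 : ℝ) / 3) * (secondMomentConst K * (3 * corrBound j k)) :=
        Finset.sum_le_sum fun j _ => Finset.sum_le_sum fun k _ =>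
          (le_abs_self _).trans (abs_integral_fifthTerm_mul_le hB hb hL hh hn j k)
    _ = 3 * secondMomentConst K * (n : ℝ) ^ (-(5 : ℝ) / 3) *
        ∑ j ∈ Finset.range N, ∑ k ∈ Finset.range N, corrBound j k := by
        simp_rw [Finset.mul_sum]
        refine Finset.sum_congr rfl fun j _ => Finset.sum_congr rfl fun k _ => ?_
        ring
    _ ≤ 3 * secondMomentConst K * (n : ℝ) ^ (-(5 : ℝ) / 3) *
        (6 * (N * (N : ℝ) ^ ((1 : ℝ) / 3))) :=
        mul_le_mul_of_nonneg_left (sum_corrBound_le N)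
          (mul_nonneg (mul_nonneg (by norm_num) (secondMomentConst_nonneg K)) (by positivity))
    _ = _ := by ring

end SecondMoment

theorem exists_bounded_lipschitz_eq {f : ℝ → ℝ} (hf : ContDiff ℝ 1 f) {M : ℝ} (hM : 0 ≤ M) :
    ∃ (h : ℝ → ℝ) (K : ℝ), (∀ x, |h x| ≤ K) ∧ (∀ x y, |h x - h y| ≤ K * |x - y|) ∧
      Continuous h ∧ ∀ x, |x| ≤ M → h x = f x := by
  have hMM : -M ≤ M := by linarith
  obtain ⟨K₁, hK₁⟩ := isCompact_Icc.exists_bound_of_continuousOn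
    (s := Set.Icc (-M) M) hf.continuous.continuousOn
  obtain ⟨K₂, hK₂⟩ := hf.contDiffOn.exists_lipschitzOnWith one_ne_zero (convex_Icc (-M) M)
    isCompact_Icc
  have hp : ∀ x, (Set.projIcc (-M) M hMM x : ℝ) ∈ Set.Icc (-M) M := fun x => Subtype.coe_prop _
  refine ⟨fun x => f (Set.projIcc (-M) M hMM x), max K₁ K₂, fun x => ?_, fun x y => ?_, ?_,
    fun x hx => ?_⟩
  · exact (hK₁ _ (hp x)).trans (le_max_left _ _)
  · have h1 := hK₂.dist_le_mul _ (hp x) _ (hp y)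
    have h2 := (LipschitzWith.projIcc hMM).dist_le_mul x y
    rw [NNReal.coe_one, one_mul, Subtype.dist_eq] at h2
    rw [Real.dist_eq] at h1 h2
    rw [Real.dist_eq] at h2
    exact (h1.trans (mul_le_mul_of_nonneg_left h2 K₂.coe_nonneg)).trans
      (mul_le_mul_of_nonneg_right (le_max_right _ _) (abs_nonneg _))
  · exact hf.continuous.comp (continuous_subtype_val.comp continuous_projIcc)
  · simp only
    rw [Set.projIcc_of_mem hMM (abs_le.1 hx)]

theorem contDiff_fifthCoeff {g φ : ℝ → ℝ} (hg : ContDiff ℝ (⊤ : ℕ∞) g)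
    (hφ : ContDiff ℝ (⊤ : ℕ∞) φ) : ContDiff ℝ 1 (fifthCoeff g φ) := by
  have h1 : ContDiff ℝ (⊤ : ℕ∞) (iteratedDeriv 5 φ) := by
    rw [iteratedDeriv_eq_iterate]
    exact hφ.iterate_deriv 5
  have h2 : ContDiff ℝ (⊤ : ℕ∞) (deriv g) := hg.iterate_deriv 1
  exact ((contDiff_const.mul (h1.comp hg)).mul (h2.pow 5)).of_le (by exact_mod_cast le_top)

theorem sum_stepError_eq (g φ b : ℝ → ℝ) (n N : ℕ) :
    φ (g (b ((N : ℝ) / n))) - φ (g (b 0))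
      - (∑ j ∈ Finset.Icc 1 N,
          ((deriv φ (g (b (((j : ℝ) - 1) / n))) + deriv φ (g (b ((j : ℝ) / n)))) / 2) *
            (g (b ((j : ℝ) / n)) - g (b (((j : ℝ) - 1) / n))))
      + (1 / 12) *
          ∑ j ∈ Finset.Icc 1 N,
            ((iteratedDeriv 3 φ (g (b (((j : ℝ) - 1) / n)))
                + iteratedDeriv 3 φ (g (b ((j : ℝ) / n)))) / 2) *
              (g (b ((j : ℝ) / n)) - g (b (((j : ℝ) - 1) / n))) ^ 3 =
      ∑ j ∈ Finset.range N, stepError g φ (b ((j : ℝ) / n)) (b (((j : ℝ) + 1) / n)) := by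
  induction N with
  | zero => simp
  | succ N ih =>
    rw [Finset.sum_range_succ, ← ih, Finset.sum_Icc_succ_top (by omega),
      Finset.sum_Icc_succ_top (by omega), stepError]
    push_cast
    rw [add_sub_cancel_right]
    ring

theorem pow_four_sum_le {ι : Type*} (s : Finset ι) (f : ι → ℝ) :
    (∑ i ∈ s, f i) ^ 4 ≤ (s.card : ℝ) ^ 3 * ∑ i ∈ s, f i ^ 4 := by
  have h1 := sq_sum_le_card_mul_sum_sq (s := s) (f := f)
  have h2 := sq_sum_le_card_mul_sum_sq (s := s) (f := fun i => f i ^ 2)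
  simp only [← pow_mul] at h2
  calc (∑ i ∈ s, f i) ^ 4 = ((∑ i ∈ s, f i) ^ 2) ^ 2 := by ring
    _ ≤ (s.card * ∑ i ∈ s, f i ^ 2) ^ 2 := pow_le_pow_left₀ (sq_nonneg _) h1 2
    _ = (s.card : ℝ) ^ 2 * (∑ i ∈ s, f i ^ 2) ^ 2 := by ring
    _ ≤ (s.card : ℝ) ^ 2 * (s.card * ∑ i ∈ s, f i ^ 4) := by gcongr
    _ = _ := by ring

section Control

variable {Ω : Type*} {B : ℝ → Ω → ℝ} {h : ℝ → ℝ} {K : ℝ}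

/-- A random variable controlling the maximum of the partial sums of `fifthTerm` up to `N`,
through their values at multiples of `m` and their oscillation in between. -/
def meshControl (h : ℝ → ℝ) (B : ℝ → Ω → ℝ) (n N m : ℕ) (ω : Ω) : ℝ :=
  ∑ b ∈ Finset.range (N / m + 1), (∑ j ∈ Finset.range (m * b), fifthTerm h B n j ω) ^ 2 +
    (m : ℝ) ^ 3 * ∑ j ∈ Finset.range N, |meshIncr B n j ω| ^ 20 +
    ∑ j ∈ Finset.range N, |meshIncr B n j ω| ^ 7

theorem meshControl_nonneg (n N m : ℕ) (ω : Ω) : 0 ≤ meshControl h B n N m ω := by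
  unfold meshControl
  positivity

theorem abs_sum_fifthTerm_le (hb : ∀ x, |h x| ≤ K) {n N m : ℕ} (hm : 0 < m) {ω : Ω} {η : ℝ}
    (hη : 0 ≤ η) (h1 : meshControl h B n N m ω ≤ η ^ 2)
    (h2 : K ^ 4 * meshControl h B n N m ω ≤ η ^ 4) {i : ℕ} (hi : i ≤ N) :
    |∑ j ∈ Finset.range i, fifthTerm h B n j ω| ≤ 2 * η := by
  have n1 : 0 ≤ ∑ b ∈ Finset.range (N / m + 1),
    (∑ j ∈ Finset.range (m * b), fifthTerm h B n j ω) ^ 2 := by positivity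
  have n2 : 0 ≤ (m : ℝ) ^ 3 * ∑ j ∈ Finset.range N, |meshIncr B n j ω| ^ 20 := by positivity
  have n3 : 0 ≤ ∑ j ∈ Finset.range N, |meshIncr B n j ω| ^ 7 := by positivity
  have hbi : m * (i / m) ≤ i := Nat.mul_div_le i m
  have hblock : |∑ j ∈ Finset.range (m * (i / m)), fifthTerm h B n j ω| ≤ η := by
    refine abs_le_of_sq_le_sq (le_trans ?_ h1) hη
    have := Finset.single_le_sum (f := fun b =>
      (∑ j ∈ Finset.range (m * b), fifthTerm h B n j ω) ^ 2) (fun b _ => sq_nonneg _)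
      (Finset.mem_range.2 (Nat.lt_succ_of_le (Nat.div_le_div_right (c := m) hi)))
    rw [meshControl]
    linarith
  have hosc : |∑ j ∈ Finset.Ico (m * (i / m)) i, fifthTerm h B n j ω| ≤ η := by
    refine le_of_pow_le_pow_left₀ four_ne_zero hη (le_trans ?_ h2)
    rw [Even.pow_abs (by decide)]
    have hcard : ((Finset.Ico (m * (i / m)) i).card : ℝ) ≤ m := by
      rw [Nat.card_Ico]
      have := Nat.mod_lt i hm
      have := Nat.div_add_mod i m
      exact_mod_cast (by omega : i - m * (i / m) ≤ m)
    have hterm : ∀ j, fifthTerm h B n j ω ^ 4 ≤ K ^ 4 * |meshIncr B n j ω| ^ 20 := by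
      intro j
      have hK : h (meshMid B n j ω) ^ 4 ≤ K ^ 4 := by
        rw [← Even.pow_abs (by decide)]
        exact pow_le_pow_left₀ (abs_nonneg _) (hb _) 4
      rw [fifthTerm, mul_pow, ← pow_mul, Even.pow_abs (by decide)]
      exact mul_le_mul_of_nonneg_right hK (Even.pow_nonneg (by decide) _)
    calc _ ≤ ((Finset.Ico (m * (i / m)) i).card : ℝ) ^ 3 *
          ∑ j ∈ Finset.Ico (m * (i / m)) i, fifthTerm h B n j ω ^ 4 := pow_four_sum_le _ _
      _ ≤ (m : ℝ) ^ 3 * ∑ j ∈ Finset.range N, K ^ 4 * |meshIncr B n j ω| ^ 20 := by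
        gcongr
        refine (Finset.sum_le_sum fun j _ => hterm j).trans
          (Finset.sum_le_sum_of_subset_of_nonneg (fun j hj => ?_) fun j _ _ => by positivity)
        rw [Finset.mem_Ico] at hj
        exact Finset.mem_range.2 (hj.2.trans_le hi)
      _ = K ^ 4 * ((m : ℝ) ^ 3 * ∑ j ∈ Finset.range N, |meshIncr B n j ω| ^ 20) := by
        rw [← Finset.mul_sum]; ring
      _ ≤ _ := by
        gcongr
        rw [meshControl]
        linarith
  rw [← Finset.sum_range_add_sum_Ico _ hbi, two_mul]
  exact (abs_add_le _ _).trans (add_le_add hblock hosc)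

theorem abs_sum_le_of_meshControl_le (hb : ∀ x, |h x| ≤ K) {n N m : ℕ} (hm : 0 < m) {ω : Ω}
    {η C : ℝ} (hη : 0 ≤ η) (hC : 0 ≤ C) {d : ℕ → ℝ}
    (hd : ∀ j < N, |d j - fifthTerm h B n j ω| ≤ C * |meshIncr B n j ω| ^ 7)
    (h1 : meshControl h B n N m ω ≤ η ^ 2) (h2 : K ^ 4 * meshControl h B n N m ω ≤ η ^ 4)
    (h3 : C * meshControl h B n N m ω ≤ η) {i : ℕ} (hi : i ≤ N) :
    |∑ j ∈ Finset.range i, d j| ≤ 3 * η := by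
  have hmain := abs_sum_fifthTerm_le hb hm hη h1 h2 hi
  have hrem : |∑ j ∈ Finset.range i, (d j - fifthTerm h B n j ω)| ≤ η :=
    calc _ ≤ ∑ j ∈ Finset.range i, |d j - fifthTerm h B n j ω| := Finset.abs_sum_le_sum_abs _ _
      _ ≤ ∑ j ∈ Finset.range i, C * |meshIncr B n j ω| ^ 7 :=
        Finset.sum_le_sum fun j hj => hd j ((Finset.mem_range.1 hj).trans_le hi)
      _ ≤ C * ∑ j ∈ Finset.range N, |meshIncr B n j ω| ^ 7 := by
        rw [← Finset.mul_sum]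
        gcongr
      _ ≤ C * meshControl h B n N m ω := by
        gcongr
        rw [meshControl]
        refine le_add_of_nonneg_left ?_
        positivity
      _ ≤ η := h3
  have e : ∑ j ∈ Finset.range i, d j = ∑ j ∈ Finset.range i, fifthTerm h B n j ω +
      ∑ j ∈ Finset.range i, (d j - fifthTerm h B n j ω) := by
    rw [← Finset.sum_add_distrib]
    exact Finset.sum_congr rfl fun j _ => by ring
  rw [e]
  linarith [abs_add_le (∑ j ∈ Finset.range i, fifthTerm h B n j ω)
    (∑ j ∈ Finset.range i, (d j - fifthTerm h B n j ω))]

variable [MeasureSpace Ω] [IsProbabilityMeasure (volume : Measure Ω)]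

theorem integral_meshControl_le (hB : IsFBM16 B) (hb : ∀ x, |h x| ≤ K)
    (hL : ∀ x y, |h x - h y| ≤ K * |x - y|) (hh : Continuous h) {n : ℕ} (hn : 0 < n) (N m : ℕ) :
    Integrable (meshControl h B n N m) ∧ ∫ ω, meshControl h B n N m ω ≤
      ((N : ℝ) / m + 1) * (18 * secondMomentConst K * (n : ℝ) ^ (-(5 : ℝ) / 3) *
        (N * (N : ℝ) ^ ((1 : ℝ) / 3))) +
      (m : ℝ) ^ 3 * (N * (gaussMoment 20 * (n : ℝ) ^ (-(20 : ℝ) / 6))) +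
      N * (gaussMoment 7 * (n : ℝ) ^ (-(7 : ℝ) / 6)) := by
  have hS := integral_sum_fifthTerm_sq_le hB hb hL hh hn
  have I1 : Integrable (fun ω => ∑ b ∈ Finset.range (N / m + 1),
      (∑ j ∈ Finset.range (m * b), fifthTerm h B n j ω) ^ 2) :=
    integrable_finsetSum _ fun b _ => (hS (m * b)).1
  have I2 : ∀ p, Integrable (fun ω => ∑ j ∈ Finset.range N, |meshIncr B n j ω| ^ p) := fun p =>
    integrable_finsetSum _ fun j _ => integrable_abs_meshIncr_pow hB hn j p
  have I3 : Integrable (fun ω => (m : ℝ) ^ 3 * ∑ j ∈ Finset.range N, |meshIncr B n j ω| ^ 20) :=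
    (I2 20).const_mul _
  have I13 : Integrable (fun ω => ∑ b ∈ Finset.range (N / m + 1),
      (∑ j ∈ Finset.range (m * b), fifthTerm h B n j ω) ^ 2 +
      (m : ℝ) ^ 3 * ∑ j ∈ Finset.range N, |meshIncr B n j ω| ^ 20) := I1.add I3
  refine ⟨I13.add (I2 7), ?_⟩
  have hpow : ∀ p : ℕ, ∫ ω, ∑ j ∈ Finset.range N, |meshIncr B n j ω| ^ p =
      N * (gaussMoment p * (n : ℝ) ^ (-(p : ℝ) / 6)) := fun p => by
    rw [integral_finsetSum _ fun j _ => integrable_abs_meshIncr_pow hB hn j p]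
    simp [integral_abs_meshIncr_pow hB hn]
  have hsq : ∫ ω, ∑ b ∈ Finset.range (N / m + 1),
      (∑ j ∈ Finset.range (m * b), fifthTerm h B n j ω) ^ 2 ≤
      ((N : ℝ) / m + 1) * (18 * secondMomentConst K * (n : ℝ) ^ (-(5 : ℝ) / 3) *
        (N * (N : ℝ) ^ ((1 : ℝ) / 3))) := by
    have hc : 0 ≤ 18 * secondMomentConst K * (n : ℝ) ^ (-(5 : ℝ) / 3) :=
      mul_nonneg (mul_nonneg (by norm_num) (secondMomentConst_nonneg K)) (by positivity)
    rw [integral_finsetSum _ fun b _ => (hS (m * b)).1]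
    calc _ ≤ ∑ b ∈ Finset.range (N / m + 1), 18 * secondMomentConst K *
          (n : ℝ) ^ (-(5 : ℝ) / 3) * (N * (N : ℝ) ^ ((1 : ℝ) / 3)) := by
          refine Finset.sum_le_sum fun b hb => (hS (m * b)).2.trans ?_
          have hbN : ((m * b : ℕ) : ℝ) ≤ N := by
            exact_mod_cast (Nat.mul_le_mul_left m
              (Nat.lt_succ_iff.1 (Finset.mem_range.1 hb))).trans (Nat.mul_div_le N m)
          gcongr
      _ = (((N / m : ℕ) : ℝ) + 1) * (18 * secondMomentConst K *
          (n : ℝ) ^ (-(5 : ℝ) / 3) * (N * (N : ℝ) ^ ((1 : ℝ) / 3))) := by simp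
      _ ≤ _ := by
        refine mul_le_mul_of_nonneg_right (add_le_add_left Nat.cast_div_le 1) ?_
        exact mul_nonneg hc (by positivity)
  have h20 := hpow 20
  have h7 := hpow 7
  push_cast at h20 h7
  simp only [meshControl]
  rw [integral_add I13 (I2 7), integral_add I1 I3, integral_const_mul, h20, h7]
  linarith

end Control

section Conclusion

variable {Ω : Type*} [MeasureSpace Ω] [IsProbabilityMeasure (volume : Measure Ω)] {B : ℝ → Ω → ℝ}

theorem integral_meshControl_le_rpow (hB : IsFBM16 B) {h : ℝ → ℝ} {K : ℝ} (hb : ∀ x, |h x| ≤ K)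
    (hL : ∀ x y, |h x - h y| ≤ K * |x - y|) (hh : Continuous h) {T : ℝ} (hT : 0 ≤ T) {n : ℕ}
    (hn : 0 < n) :
    ∫ ω, meshControl h B n ⌊(n : ℝ) * T⌋₊ ⌈(n : ℝ) ^ ((3 : ℝ) / 4)⌉₊ ω ≤
      ((T + 1) * (18 * secondMomentConst K * (T * T ^ ((1 : ℝ) / 3))) + 8 * (T * gaussMoment 20) +
        T * gaussMoment 7) * (n : ℝ) ^ (-((1 : ℝ) / 12)) := by
  refine (integral_meshControl_le hB hb hL hh hn _ _).2.trans ?_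
  have hn0 : (0 : ℝ) ≤ n := Nat.cast_nonneg n
  have hn1 : (1 : ℝ) ≤ n := by exact_mod_cast hn
  have hC := secondMomentConst_nonneg K
  have hγ := gaussMoment_nonneg
  set r : ℝ := (n : ℝ) ^ ((1 : ℝ) / 12) with hr
  have hr1 : 1 ≤ r := Real.one_le_rpow hn1 (by norm_num)
  have hr0 : 0 < r := by linarith
  have hpow : ∀ k : ℕ, (n : ℝ) ^ ((k : ℝ) / 12) = r ^ k := fun k => by
    rw [hr, ← Real.rpow_natCast, ← Real.rpow_mul hn0]
    ring_nf
  have hneg : ∀ k : ℕ, (n : ℝ) ^ (-((k : ℝ) / 12)) = (r ^ k)⁻¹ := fun k => by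
    rw [Real.rpow_neg hn0, hpow]
  have e1 : (n : ℝ) ^ (-(5 : ℝ) / 3) = (r ^ 20)⁻¹ := by rw [← hneg]; norm_num
  have e2 : (n : ℝ) ^ (-(20 : ℝ) / 6) = (r ^ 40)⁻¹ := by rw [← hneg]; norm_num
  have e3 : (n : ℝ) ^ (-(7 : ℝ) / 6) = (r ^ 14)⁻¹ := by rw [← hneg]; norm_num
  have e4 : (n : ℝ) ^ (-((1 : ℝ) / 12)) = r⁻¹ := by rw [Real.rpow_neg hn0]
  have e5 : (n : ℝ) ^ ((3 : ℝ) / 4) = r ^ 9 := by rw [← hpow]; norm_num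
  have e6 : (n : ℝ) = r ^ 12 := by rw [← hpow]; norm_num
  rw [e1, e2, e3, e4, e5]
  set N := ⌊(n : ℝ) * T⌋₊
  set m := ⌈r ^ 9⌉₊
  have hN : (N : ℝ) ≤ r ^ 12 * T := by
    rw [← e6]
    exact Nat.floor_le (by positivity)
  have hm1 : r ^ 9 ≤ m := Nat.le_ceil _
  have hm2 : (m : ℝ) ≤ 2 * r ^ 9 := by
    have h1 := Nat.ceil_lt_add_one (by positivity : 0 ≤ r ^ 9)
    have h2 : 1 ≤ r ^ 9 := one_le_pow₀ hr1
    linarith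
  have hN3 : (N : ℝ) ^ ((1 : ℝ) / 3) ≤ r ^ 4 * T ^ ((1 : ℝ) / 3) := by
    refine (Real.rpow_le_rpow (Nat.cast_nonneg N) hN (by norm_num)).trans_eq ?_
    rw [Real.mul_rpow (by positivity) hT, ← e6, ← hpow]
    norm_num
  have hNm : (N : ℝ) / m + 1 ≤ r ^ 3 * (T + 1) := by
    have h1 : (N : ℝ) / m ≤ r ^ 12 * T / r ^ 9 := by gcongr
    have h2 : r ^ 12 * T / r ^ 9 = r ^ 3 * T := by field_simp
    have h3 : 1 ≤ r ^ 3 := one_le_pow₀ hr1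
    linarith
  have t1 : ((N : ℝ) / m + 1) * (18 * secondMomentConst K * (r ^ 20)⁻¹ *
      (N * (N : ℝ) ^ ((1 : ℝ) / 3))) ≤
      (T + 1) * (18 * secondMomentConst K * (T * T ^ ((1 : ℝ) / 3))) * r⁻¹ :=
    calc _ ≤ (r ^ 3 * (T + 1)) * (18 * secondMomentConst K * (r ^ 20)⁻¹ *
          (r ^ 12 * T * (r ^ 4 * T ^ ((1 : ℝ) / 3)))) := by gcongr
      _ = _ := by field_simp
  have t2 : (m : ℝ) ^ 3 * (N * (gaussMoment 20 * (r ^ 40)⁻¹)) ≤ 8 * (T * gaussMoment 20) * r⁻¹ :=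
    calc _ ≤ (2 * r ^ 9) ^ 3 * (r ^ 12 * T * (gaussMoment 20 * (r ^ 40)⁻¹)) := by
          have := hγ 20
          gcongr
      _ = _ := by field_simp; ring
  have t3 : (N : ℝ) * (gaussMoment 7 * (r ^ 14)⁻¹) ≤ T * gaussMoment 7 * r⁻¹ :=
    calc _ ≤ r ^ 12 * T * (gaussMoment 7 * (r ^ 13)⁻¹) := by
          have := hγ 7
          gcongr
          · norm_num
      _ = _ := by field_simp
  linarith

theorem tendsto_measure_le_meshControl (hB : IsFBM16 B) {h : ℝ → ℝ} {K : ℝ}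
    (hb : ∀ x, |h x| ≤ K) (hL : ∀ x y, |h x - h y| ≤ K * |x - y|) (hh : Continuous h) {T : ℝ}
    (hT : 0 ≤ T) {κ : ℝ} (hκ : 0 < κ) :
    Tendsto (fun n : ℕ => volume {ω : Ω | κ ≤
      meshControl h B n ⌊(n : ℝ) * T⌋₊ ⌈(n : ℝ) ^ ((3 : ℝ) / 4)⌉₊ ω}) atTop (𝓝 0) := by
  set c := (T + 1) * (18 * secondMomentConst K * (T * T ^ ((1 : ℝ) / 3))) +
    8 * (T * gaussMoment 20) + T * gaussMoment 7
  have hlim : Tendsto (fun n : ℕ => ENNReal.ofReal (c * (n : ℝ) ^ (-((1 : ℝ) / 12)) / κ)) atTop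
      (𝓝 0) := by
    rw [← ENNReal.ofReal_zero]
    refine ENNReal.tendsto_ofReal ?_
    have := (((tendsto_rpow_neg_atTop (by norm_num : (0 : ℝ) < 1 / 12)).comp
      tendsto_natCast_atTop_atTop).const_mul c).div_const κ
    simpa using this
  refine tendsto_of_tendsto_of_tendsto_of_le_of_le' tendsto_const_nhds hlim
    (Eventually.of_forall fun _ => zero_le) ?_
  filter_upwards [eventually_gt_atTop 0] with n hn
  have hmk := mul_meas_ge_le_integral_of_nonneg
    (ae_of_all _ fun ω => meshControl_nonneg n ⌊(n : ℝ) * T⌋₊ ⌈(n : ℝ) ^ ((3 : ℝ) / 4)⌉₊ ω)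
    (integral_meshControl_le hB hb hL hh hn ⌊(n : ℝ) * T⌋₊ ⌈(n : ℝ) ^ ((3 : ℝ) / 4)⌉₊).1 κ
  rw [← ofReal_measureReal]
  refine ENNReal.ofReal_le_ofReal ?_
  rw [le_div_iff₀' hκ]
  exact hmk.trans (integral_meshControl_le_rpow hB hb hL hh hT hn)

theorem exists_measure_not_bounded_le (hB : IsFBM16 B) (T : ℝ) {δ : ENNReal} (hδ : 0 < δ) :
    ∃ M : ℕ, volume {ω : Ω | ∀ t ∈ Set.Icc (0 : ℝ) T, |B t ω| ≤ M}ᶜ ≤ δ := by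
  have hcont : ∀ ω, Continuous fun t => |B (max 0 (min t T)) ω| := fun ω =>
    ((hB.2.1 ω).comp (continuous_const.max (continuous_id.min continuous_const))).abs
  have hset : ∀ M : ℕ, {ω : Ω | ∀ q : ℚ, |B (max 0 (min (q : ℝ) T)) ω| ≤ M} ⊆
      {ω : Ω | ∀ t ∈ Set.Icc (0 : ℝ) T, |B t ω| ≤ M} := by
    intro M ω hω t ht
    have := Rat.denseRange_cast.induction_on (p := fun t : ℝ => |B (max 0 (min t T)) ω| ≤ M) t
      (isClosed_le (hcont ω) continuous_const) hω
    simpa [min_eq_left ht.2, max_eq_right ht.1] using this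
  have hmeas : ∀ M : ℕ, MeasurableSet {ω : Ω | ∀ q : ℚ, |B (max 0 (min (q : ℝ) T)) ω| ≤ M} := by
    intro M
    rw [Set.ofPred_forall]
    exact MeasurableSet.iInter fun q => measurableSet_le (hB.1 _).abs measurable_const
  have hanti : Antitone fun M : ℕ => {ω : Ω | ∀ q : ℚ, |B (max 0 (min (q : ℝ) T)) ω| ≤ M}ᶜ := by
    intro M M' hM ω hω hω'
    exact hω fun q => (hω' q).trans (by exact_mod_cast hM)
  have hempty : ⋂ M : ℕ, {ω : Ω | ∀ q : ℚ, |B (max 0 (min (q : ℝ) T)) ω| ≤ M}ᶜ = ∅ := by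
    refine Set.eq_empty_of_forall_notMem fun ω hω => ?_
    rcases le_total 0 T with hT | hT
    · obtain ⟨C, hC⟩ := isCompact_Icc.exists_bound_of_continuousOn (s := Set.Icc 0 T)
        (hB.2.1 ω).continuousOn
      obtain ⟨M, hM⟩ := exists_nat_ge C
      exact Set.mem_iInter.1 hω M fun q =>
        (hC _ ⟨le_max_left _ _, max_le hT (min_le_right _ _)⟩).trans hM
    · obtain ⟨M, hM⟩ := exists_nat_ge |B 0 ω|
      refine Set.mem_iInter.1 hω M fun q => ?_
      rwa [max_eq_left ((min_le_right _ _).trans hT)]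
  have hlim := tendsto_measure_iInter_atTop (μ := (volume : Measure Ω))
    (fun M => (hmeas M).compl.nullMeasurableSet) hanti ⟨0, measure_ne_top _ _⟩
  rw [hempty, measure_empty] at hlim
  obtain ⟨M, hM⟩ := (ENNReal.tendsto_nhds_zero.1 hlim δ hδ).exists
  exact ⟨M, (measure_mono (Set.compl_subset_compl.2 (hset M))).trans hM⟩

end Conclusion

/-- Itô-type formula
`φ(Y(t)) = φ(Y(0)) + ∫₀ᵗ φ'(Y) dY - (1/12) ∫₀ᵗ φ'''(Y) d⟦Y⟧` for `Y = g(B)`,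
at the level of Riemann-sum representatives. -/
theorem stmt16 {Ω : Type*} [MeasureSpace Ω] [IsProbabilityMeasure (volume : Measure Ω)]
    (B : ℝ → Ω → ℝ) (hB : IsFBM16 B)
    (g φ : ℝ → ℝ) (hg : ContDiff ℝ (⊤ : ℕ∞) g) (hφ : ContDiff ℝ (⊤ : ℕ∞) φ)
    (Y : ℝ → Ω → ℝ) (hY : ∀ t ω, Y t ω = g (B t ω)) :
    ∀ T > (0 : ℝ), ∀ ε > (0 : ℝ),
      Tendsto (fun n : ℕ =>
          volume {ω : Ω | ε ≤
            ⨆ t ∈ Set.Icc (0 : ℝ) T,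
              |φ (Y ((⌊(n : ℝ) * t⌋₊ : ℝ) / n) ω) - φ (Y 0 ω)
                - (∑ j ∈ Finset.Icc 1 ⌊(n : ℝ) * t⌋₊,
                    ((deriv φ (Y (((j : ℝ) - 1) / n) ω) + deriv φ (Y ((j : ℝ) / n) ω)) / 2) *
                      (Y ((j : ℝ) / n) ω - Y (((j : ℝ) - 1) / n) ω))
                + (1 / 12) *
                    ∑ j ∈ Finset.Icc 1 ⌊(n : ℝ) * t⌋₊,
                      ((iteratedDeriv 3 φ (Y (((j : ℝ) - 1) / n) ω)
                          + iteratedDeriv 3 φ (Y ((j : ℝ) / n) ω)) / 2) *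
                        (Y ((j : ℝ) / n) ω - Y (((j : ℝ) - 1) / n) ω) ^ 3|})
        atTop (𝓝 0) := by
  intro T hT ε hε
  rw [ENNReal.tendsto_nhds_zero]
  intro δ hδ
  have hδ2 : 0 < δ / 2 := ENNReal.half_pos hδ.ne'
  obtain ⟨M, hM⟩ := exists_measure_not_bounded_le hB T hδ2
  obtain ⟨h, K, hb, hL, hh, hfh⟩ :=
    exists_bounded_lipschitz_eq (contDiff_fifthCoeff hg hφ) (Nat.cast_nonneg M)
  obtain ⟨C, hC, hstep⟩ := exists_stepError_bound hg hφ M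
  set η : ℝ := ε / 4 with hη
  have hη0 : 0 < η := by positivity
  set κ : ℝ := min (η ^ 2) (min (η ^ 4 / (K ^ 4 + 1)) (η / (C + 1))) with hκ
  have hκ0 : 0 < κ := lt_min (by positivity) (lt_min (by positivity) (by positivity))
  filter_upwards [eventually_gt_atTop 0,
    ENNReal.tendsto_nhds_zero.1 (tendsto_measure_le_meshControl hB hb hL hh hT.le hκ0) _ hδ2]
    with n hn hQ
  rw [← ENNReal.add_halves δ]
  refine le_trans (measure_mono fun ω hω => ?_)
    ((measure_union_le _ _).trans (add_le_add hM hQ))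
  by_contra hnot
  simp only [Set.mem_union, not_or, Set.mem_compl_iff, not_not] at hnot
  obtain ⟨hbd, hQω⟩ := hnot
  have hbd : ∀ t ∈ Set.Icc (0 : ℝ) T, |B t ω| ≤ M := hbd
  have hQω : meshControl h B n ⌊(n : ℝ) * T⌋₊ ⌈(n : ℝ) ^ ((3 : ℝ) / 4)⌉₊ ω < κ := not_le.1 hQω
  have hnR : (0 : ℝ) < n := by exact_mod_cast hn
  have hm : 0 < ⌈(n : ℝ) ^ ((3 : ℝ) / 4)⌉₊ := Nat.ceil_pos.2 (by positivity)
  have hQ0 := meshControl_nonneg (h := h) (B := B) n ⌊(n : ℝ) * T⌋₊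
    ⌈(n : ℝ) ^ ((3 : ℝ) / 4)⌉₊ ω
  have h1 := hQω.le.trans (min_le_left _ _)
  have h2 := (le_div_iff₀' (by positivity)).1
    (hQω.le.trans ((min_le_right _ _).trans (min_le_left _ _)))
  have h3 := (le_div_iff₀' (by positivity)).1
    (hQω.le.trans ((min_le_right _ _).trans (min_le_right _ _)))
  have hd : ∀ j < ⌊(n : ℝ) * T⌋₊,
      |stepError g φ (B ((j : ℝ) / n) ω) (B (((j : ℝ) + 1) / n) ω) - fifthTerm h B n j ω| ≤
        C * |meshIncr B n j ω| ^ 7 := by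
    intro j hj
    have hjT : ((j : ℝ) + 1) / n ≤ T := by
      rw [div_le_iff₀' hnR]
      refine le_trans ?_ (Nat.floor_le (by positivity : 0 ≤ (n : ℝ) * T))
      exact_mod_cast hj
    have hj0 : (j : ℝ) / n ≤ ((j : ℝ) + 1) / n := by gcongr; linarith
    have hx := hbd ((j : ℝ) / n) ⟨by positivity, hj0.trans hjT⟩
    have hy := hbd (((j : ℝ) + 1) / n) ⟨by positivity, hjT⟩
    have := hstep _ _ hx hy
    rwa [← hfh _ (abs_half_add_le hx hy)] at this
  have hω' : ε ≤ 3 * η := by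
    refine le_trans hω (Real.iSup_le (fun t => Real.iSup_le (fun ht => ?_) (by positivity))
      (by positivity))
    simp only [hY]
    rw [sum_stepError_eq g φ (fun s => B s ω)]
    refine abs_sum_le_of_meshControl_le hb hm hη0.le hC hd h1 (by linarith) (by linarith)
      (Nat.floor_le_floor ?_)
    exact mul_le_mul_of_nonneg_left ht.2 hnR.le
  linarith
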